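/- Existence and uniform bound for multiscale correctors under logarithmic scale separation (Theorem 3.5): Let n ≥ 2, d ≥ 1, λ ∈ (0,1], C₀ ≥ 1, Λ₀ > 0, and let A : (ℝ^d)^n → ℝ^{d×d} be smooth, multiperiodic and λ-elliptic with ‖|D^ℓ A|‖_{L∞} ≤ C₀·Λ₀^ℓ·ℓ! for all ℓ ∈ ℕ. Then there exist constants cⱼ > 0 (for 2 ≤ j ≤ n), c > 0, C ≥ 1, C* ≥ 1 and Λ ≥ 1, depending only on d, n, λ, C₀, Λ₀, such that the following holds. Let 1 ≥ ε₁ > ε₂ > ⋯ > εₙ > 0 satisfy εⱼ ≤ cⱼ·εⱼ₋₁/(1 + log(ε₁/εⱼ₋₁)) for every 2 ≤ j ≤ n, set δᵢ = εᵢ/ε₁ for i = 1,…,n, let τ ∈ (0,1] satisfy τ² ≥ max over 2 ≤ j ≤ n of e^{−c·εⱼ₋₁/εⱼ}, and let v ∈ ℝ^d be a unit vector. Then there is exactly one smooth multiperiodic 𝒳 : (ℝ^d)^n → ℝ solving −∇̂·(A ∇̂𝒳) + τ²·𝒳 = ∇̂·(A v) pointwise, and it satisfies ‖𝒳‖_{L∞}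 ≤ C and, for every ℓ ∈ ℕ, ‖|D^ℓ(∇̂𝒳)|‖_{L²} + τ·‖|D^ℓ 𝒳|‖_{L²} ≤ C*·Λ^ℓ·ℓ!. -/

import Mathlib

open MeasureTheory Real

noncomputable section

namespace MS

/-- Points of `(ℝ^d)^n`. -/
abbrev Dom (d n : ℕ) := Fin n → Fin d → ℝ

/-- Partial derivative of `u` in the coordinate direction `y_i^k`. -/
def pd {d n : ℕ} (i : Fin n) (k : Fin d) (u : Dom d n → ℝ) (y : Dom d n) : ℝ :=
  fderiv ℝ u y (Pi.single i (Pi.single k 1))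

/-- Multiperiodicity: invariance under integer translations in each argument. -/
def MPeriodic {d n : ℕ} (u : Dom d n → ℝ) : Prop :=
  ∀ (y : Dom d n) (z : Fin n → Fin d → ℤ), u (fun i k => y i k + (z i k : ℝ)) = u y

/-- The unit periodicity cell `[0,1]^{d × n}`. -/
def cell (d n : ℕ) : Set (Dom d n) := Set.Icc 0 1

/-- Pointwise `|D^ℓ u|`: the sum, over all ℓ-tuples of coordinate directions, of the
absolute values of the corresponding ℓ-th order partial derivatives of the scalar `u`. -/
def DAbs {d n : ℕ} (ℓ : ℕ) (u : Dom d n → ℝ) (y : Dom d n) : ℝ :=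
  ∑ idx : Fin ℓ → Fin n × Fin d,
    |iteratedFDeriv ℝ ℓ u y fun m => Pi.single (idx m).1 (Pi.single (idx m).2 1)|

/-- L² norm over the unit cell. -/
def L2 {d n : ℕ} (F : Dom d n → ℝ) : ℝ :=
  Real.sqrt (∫ y in cell d n, (F y) ^ 2)

/-- k-th component of the truncated directional gradient `Σ_{i<m} δ_i⁻¹ ∂/∂y_i^k`;
with `m = n` this is the k-th component of `∇̂`. -/
def gradHatC {d n : ℕ} (δ : Fin n → ℝ) (m : ℕ) (k : Fin d) (u : Dom d n → ℝ) (y : Dom d n) : ℝ :=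
  ∑ i : Fin n, if (i : ℕ) < m then (δ i)⁻¹ * pd i k u y else 0

/-- λ-ellipticity of a matrix-valued map: `ξ·Aξ ≥ λ|ξ|²` and `|Aξ| ≤ λ⁻¹|ξ|`. -/
def Elliptic {d n : ℕ} (lam : ℝ) (A : Dom d n → Fin d → Fin d → ℝ) : Prop :=
  ∀ (y : Dom d n) (ξ : Fin d → ℝ),
    (lam * ∑ k, ξ k ^ 2 ≤ ∑ k, ξ k * ∑ l, A y k l * ξ l) ∧
    Real.sqrt (∑ k, (∑ l, A y k l * ξ l) ^ 2) ≤ lam⁻¹ * Real.sqrt (∑ k, ξ k ^ 2)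

/-! ### Exponentially weighted sequences on a lattice -/

section Weights

variable {ι : Type*} [Fintype ι]

/-- The `ℓ¹` norm of a lattice point. -/
def latNorm (m : ι → ℤ) : ℝ := ∑ p, |(m p : ℝ)|

lemma latNorm_nonneg (m : ι → ℤ) : 0 ≤ latNorm m :=
  Finset.sum_nonneg fun _ _ => abs_nonneg _

lemma latNorm_zero : latNorm (0 : ι → ℤ) = 0 := by simp [latNorm]

lemma latNorm_add_le (m q : ι → ℤ) : latNorm (m + q) ≤ latNorm m + latNorm q := by
  simp only [latNorm, ← Finset.sum_add_distrib]
  refine Finset.sum_le_sum fun p _ => ?_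
  simpa using abs_add_le (m p : ℝ) (q p)

lemma abs_latNorm_sub_le (m j : ι → ℤ) : |latNorm m - latNorm j| ≤ latNorm (m - j) := by
  have h1 := latNorm_add_le (m - j) j
  have h2 := latNorm_add_le (j - m) m
  have h3 : latNorm (j - m) = latNorm (m - j) := by
    simp only [latNorm, Pi.sub_apply, Int.cast_sub]
    exact Finset.sum_congr rfl fun p _ => abs_sub_comm _ _
  rw [sub_add_cancel] at h1 h2
  rw [abs_le]
  constructor <;> linarith

lemma summable_exp_neg_abs {a : ℝ} (ha : 0 < a) :
    Summable fun z : ℤ => Real.exp (-(a * |(z : ℝ)|)) := by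
  have h : Summable fun k : ℕ => Real.exp (-(a * (k : ℝ))) := by
    have := Real.summable_exp_nat_mul_iff.mpr (neg_lt_zero.mpr ha)
    refine this.congr fun k => ?_
    congr 1; ring
  refine Summable.of_nat_of_neg ?_ ?_ <;> simpa using h

lemma summable_exp_latNorm {a : ℝ} (ha : 0 < a) :
    Summable fun m : ι → ℤ => Real.exp (-(a * latNorm m)) := by
  classical
  refine summable_of_sum_le (c := ∏ _p : ι, ∑' z : ℤ, Real.exp (-(a * |(z : ℝ)|)))
    (fun _ => (Real.exp_pos _).le) fun F => ?_
  calc ∑ m ∈ F, Real.exp (-(a * latNorm m))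
      ≤ ∑ m ∈ Fintype.piFinset (fun p => F.image fun m : ι → ℤ => m p),
          Real.exp (-(a * latNorm m)) := by
        refine Finset.sum_le_sum_of_subset_of_nonneg (fun m hm => ?_)
          fun _ _ _ => (Real.exp_pos _).le
        exact Fintype.mem_piFinset.mpr fun p => Finset.mem_image_of_mem _ hm
    _ = ∑ m ∈ Fintype.piFinset (fun p => F.image fun m : ι → ℤ => m p),
          ∏ p, Real.exp (-(a * |(m p : ℝ)|)) := by
        refine Finset.sum_congr rfl fun m _ => ?_
        rw [← Real.exp_sum, latNorm, Finset.mul_sum, Finset.sum_neg_distrib]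
    _ = ∏ p, ∑ z ∈ F.image (fun m : ι → ℤ => m p), Real.exp (-(a * |(z : ℝ)|)) := by
        rw [Finset.prod_univ_sum]
    _ ≤ _ := by
        refine Finset.prod_le_prod
          (fun _ _ => Finset.sum_nonneg fun _ _ => (Real.exp_pos _).le) fun p _ => ?_
        exact (summable_exp_neg_abs ha).sum_le_tsum _ fun _ _ => (Real.exp_pos _).le

lemma sum_sub_le_tsum {M : Type*} [AddCommGroup M] {β : M → ℝ} (h0 : ∀ m, 0 ≤ β m)
    (hβ : Summable β) (F : Finset M) (m : M) : ∑ j ∈ F, β (m - j) ≤ ∑' q, β q := by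
  have h := (Equiv.subLeft m).summable_iff.mpr hβ
  have h2 := h.sum_le_tsum F fun _ _ => h0 _
  rw [(Equiv.subLeft m).tsum_eq] at h2
  simpa using h2

lemma sum_sub_le_tsum' {M : Type*} [AddCommGroup M] {β : M → ℝ} (h0 : ∀ m, 0 ≤ β m)
    (hβ : Summable β) (F : Finset M) (j : M) : ∑ m ∈ F, β (m - j) ≤ ∑' q, β q := by
  have h := (Equiv.subRight j).summable_iff.mpr hβ
  have h2 := h.sum_le_tsum F fun _ _ => h0 _
  rw [(Equiv.subRight j).tsum_eq] at h2
  simpa using h2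

/-- Schur's test for convolution kernels. -/
lemma schur_conv {M : Type*} [AddCommGroup M] {β : M → ℝ} (h0 : ∀ m, 0 ≤ β m)
    (hβ : Summable β) (F : Finset M) (f g : M → ℝ) :
    ∑ m ∈ F, ∑ j ∈ F, β (m - j) * (f m * g j)
      ≤ (∑' q, β q) / 2 * (∑ m ∈ F, f m ^ 2 + ∑ m ∈ F, g m ^ 2) := by
  have h1 : ∑ m ∈ F, ∑ j ∈ F, β (m - j) * f m ^ 2 ≤ (∑' q, β q) * ∑ m ∈ F, f m ^ 2 := by
    rw [Finset.mul_sum]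
    refine Finset.sum_le_sum fun m _ => ?_
    rw [← Finset.sum_mul]
    exact mul_le_mul_of_nonneg_right (sum_sub_le_tsum h0 hβ F m) (sq_nonneg _)
  have h2 : ∑ m ∈ F, ∑ j ∈ F, β (m - j) * g j ^ 2 ≤ (∑' q, β q) * ∑ m ∈ F, g m ^ 2 := by
    rw [Finset.sum_comm, Finset.mul_sum]
    refine Finset.sum_le_sum fun m _ => ?_
    rw [← Finset.sum_mul]
    exact mul_le_mul_of_nonneg_right (sum_sub_le_tsum' h0 hβ F m) (sq_nonneg _)
  have h3 : ∑ m ∈ F, ∑ j ∈ F, β (m - j) * (f m * g j)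
      ≤ ∑ m ∈ F, ∑ j ∈ F, (β (m - j) * f m ^ 2 + β (m - j) * g j ^ 2) / 2 := by
    refine Finset.sum_le_sum fun m _ => Finset.sum_le_sum fun j _ => ?_
    nlinarith [mul_nonneg (h0 (m - j)) (sq_nonneg (f m - g j))]
  simp only [← Finset.sum_div, Finset.sum_add_distrib] at h3
  linarith

end Weights

/-! ### A Galerkin scheme for coercive convolution systems -/

section Galerkin

open scoped ComplexConjugate

variable {ι : Type*} [Fintype ι] {d : ℕ}

lemma norm_exp_sub_one_le (x y : ℝ) (h : |x| ≤ y) :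
    ‖((Real.exp x : ℝ) : ℂ) - 1‖ ≤ Real.exp y - 1 := by
  rw [← Complex.ofReal_one, ← Complex.ofReal_sub, Complex.norm_real, Real.norm_eq_abs, abs_le]
  have h1 := Real.exp_le_exp.mpr ((le_abs_self x).trans h)
  have h2 := Real.exp_le_exp.mpr ((neg_le_abs x).trans h)
  have h3 : 2 ≤ Real.exp x + Real.exp (-x) := by
    have := Real.add_one_le_exp x
    have := Real.add_one_le_exp (-x)
    linarith
  constructor <;> linarith

/-- Conjugating a coercive convolution system with a slowly growing exponential weight
perturbs the quadratic form by at most half of the coercivity constant. -/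
lemma weighted_coercive {a : Fin d → Fin d → (ι → ℤ) → ℂ} {K σ s lam : ℝ} (hs : 0 < s)
    (hsσ : s < σ) (hK : 0 ≤ K)
    (ha : ∀ k l m, ‖a k l m‖ ≤ K * Real.exp (-(σ * latNorm m)))
    (hsmall : d * ∑' m : ι → ℤ,
      K * (Real.exp (-(σ * latNorm m)) * (Real.exp (s * latNorm m) - 1)) ≤ lam / 2)
    (hcoer : ∀ (F : Finset (ι → ℤ)) (f : Fin d → (ι → ℤ) → ℂ),
      lam * ∑ k, ∑ m ∈ F, ‖f k m‖ ^ 2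
        ≤ (∑ k, ∑ l, ∑ m ∈ F, ∑ j ∈ F, conj (f k m) * (a k l (m - j) * f l j)).re)
    (F : Finset (ι → ℤ)) (f : Fin d → (ι → ℤ) → ℂ) :
    lam / 2 * ∑ k, ∑ m ∈ F, ‖f k m‖ ^ 2
      ≤ (∑ k, ∑ l, ∑ m ∈ F, ∑ j ∈ F, conj (f k m) *
          ((Real.exp (s * (latNorm m - latNorm j)) : ℝ) * a k l (m - j) * f l j)).re := by
  set β : (ι → ℤ) → ℝ := fun m =>
    K * (Real.exp (-(σ * latNorm m)) * (Real.exp (s * latNorm m) - 1)) with hβ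
  have hexp1 : ∀ m : ι → ℤ, 0 ≤ Real.exp (s * latNorm m) - 1 := fun m =>
    sub_nonneg.mpr (Real.one_le_exp (mul_nonneg hs.le (latNorm_nonneg m)))
  have hβ0 : ∀ m, 0 ≤ β m := fun m =>
    mul_nonneg hK (mul_nonneg (Real.exp_pos _).le (hexp1 m))
  have hβs : Summable β := by
    refine Summable.mul_left K ?_
    refine Summable.of_nonneg_of_le (fun m => mul_nonneg (Real.exp_pos _).le (hexp1 m))
      (fun m => ?_) (summable_exp_latNorm (ι := ι) (sub_pos.mpr hsσ))
    calc Real.exp (-(σ * latNorm m)) * (Real.exp (s * latNorm m) - 1)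
        ≤ Real.exp (-(σ * latNorm m)) * Real.exp (s * latNorm m) :=
          mul_le_mul_of_nonneg_left (by linarith) (Real.exp_pos _).le
      _ = _ := by rw [← Real.exp_add]; congr 1; ring
  have hdiff : ‖(∑ k, ∑ l, ∑ m ∈ F, ∑ j ∈ F, conj (f k m) *
          ((Real.exp (s * (latNorm m - latNorm j)) : ℝ) * a k l (m - j) * f l j))
        - ∑ k, ∑ l, ∑ m ∈ F, ∑ j ∈ F, conj (f k m) * (a k l (m - j) * f l j)‖
      ≤ lam / 2 * ∑ k, ∑ m ∈ F, ‖f k m‖ ^ 2 := by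
    simp only [← Finset.sum_sub_distrib]
    have hterm : ∀ k l : Fin d, ‖∑ m ∈ F, ∑ j ∈ F, (conj (f k m) *
          ((Real.exp (s * (latNorm m - latNorm j)) : ℝ) * a k l (m - j) * f l j)
          - conj (f k m) * (a k l (m - j) * f l j))‖
        ≤ (∑' q, β q) / 2 * (∑ m ∈ F, ‖f k m‖ ^ 2 + ∑ m ∈ F, ‖f l m‖ ^ 2) := by
      intro k l
      refine le_trans ?_ (schur_conv hβ0 hβs F (fun m => ‖f k m‖) (fun m => ‖f l m‖))
      refine (norm_sum_le _ _).trans (Finset.sum_le_sum fun m _ => ?_)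
      refine (norm_sum_le _ _).trans (Finset.sum_le_sum fun j _ => ?_)
      have hfac : conj (f k m) *
          ((Real.exp (s * (latNorm m - latNorm j)) : ℝ) * a k l (m - j) * f l j)
          - conj (f k m) * (a k l (m - j) * f l j)
          = conj (f k m) * (((Real.exp (s * (latNorm m - latNorm j)) : ℝ) - 1)
            * a k l (m - j) * f l j) := by ring
      rw [hfac, norm_mul, norm_mul, norm_mul, RCLike.norm_conj]
      have h1 := norm_exp_sub_one_le (s * (latNorm m - latNorm j)) (s * latNorm (m - j)) (by
        rw [abs_mul, abs_of_pos hs]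
        exact mul_le_mul_of_nonneg_left (abs_latNorm_sub_le m j) hs.le)
      calc ‖f k m‖ * (‖((Real.exp (s * (latNorm m - latNorm j)) : ℝ) : ℂ) - 1‖
              * ‖a k l (m - j)‖ * ‖f l j‖)
          ≤ ‖f k m‖ * ((Real.exp (s * latNorm (m - j)) - 1)
              * (K * Real.exp (-(σ * latNorm (m - j)))) * ‖f l j‖) := by
            gcongr
            · exact hexp1 _
            · exact ha k l _
        _ = β (m - j) * (‖f k m‖ * ‖f l j‖) := by simp only [hβ]; ring
    calc _ ≤ ∑ k : Fin d, ∑ l : Fin d,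
          (∑' q, β q) / 2 * (∑ m ∈ F, ‖f k m‖ ^ 2 + ∑ m ∈ F, ‖f l m‖ ^ 2) := by
          refine (norm_sum_le _ _).trans (Finset.sum_le_sum fun k _ => ?_)
          exact (norm_sum_le _ _).trans (Finset.sum_le_sum fun l _ => hterm k l)
      _ = (d * ∑' q, β q) * ∑ k, ∑ m ∈ F, ‖f k m‖ ^ 2 := by
          simp only [← Finset.mul_sum, Finset.sum_add_distrib, Finset.sum_const,
            Finset.card_univ, Fintype.card_fin, nsmul_eq_mul]
          ring
      _ ≤ _ := mul_le_mul_of_nonneg_right hsmall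
          (Finset.sum_nonneg fun _ _ => Finset.sum_nonneg fun _ _ => sq_nonneg _)
  have h1 := (Complex.abs_re_le_norm _).trans hdiff
  rw [Complex.sub_re, abs_le] at h1
  have h2 := hcoer F f
  linarith [h1.1]

lemma energy_absorb {lam D S T : ℝ} (hlam : 0 < lam) (hlam1 : lam ≤ 1) (hD : 0 ≤ D)
    (hS : 0 ≤ S) (hT : 0 ≤ T) (h : T + lam / 2 * S ≤ D * √S) :
    √S ≤ 2 * D / lam ∧ T ≤ (2 * D / lam) ^ 2 := by
  have hsq : √S ^ 2 = S := Real.sq_sqrt hS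
  have hr0 := Real.sqrt_nonneg S
  have hSle : √S ≤ 2 * D / lam := by
    rw [le_div_iff₀ hlam]
    rcases hr0.eq_or_lt with h0 | h0
    · rw [← h0]; linarith
    · refine le_of_mul_le_mul_right ?_ h0
      nlinarith
  refine ⟨hSle, ?_⟩
  have h1 : D ≤ 2 * D / lam := by
    rw [le_div_iff₀ hlam]; nlinarith
  have h2 : D * √S ≤ (2 * D / lam) * (2 * D / lam) :=
    mul_le_mul h1 hSle hr0 (hD.trans h1)
  nlinarith [mul_nonneg hlam.le hS]

/-- Weighted energy estimate for solutions of the truncated system. -/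
lemma galerkin_bound {a : Fin d → Fin d → (ι → ℤ) → ℂ} {b : Fin d → (ι → ℤ) → ℂ}
    {σ s lam τ B : ℝ} (hsσ : s < σ) (hlam : 0 < lam) (hlam1 : lam ≤ 1)
    (hB : 0 ≤ B)
    (hb : ∀ k m, ‖b k m‖ ≤ B * Real.exp (-(σ * latNorm m)))
    (hcoer : ∀ (F : Finset (ι → ℤ)) (f : Fin d → (ι → ℤ) → ℂ),
      lam / 2 * ∑ k, ∑ m ∈ F, ‖f k m‖ ^ 2
      ≤ (∑ k, ∑ l, ∑ m ∈ F, ∑ j ∈ F, conj (f k m) *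
          ((Real.exp (s * (latNorm m - latNorm j)) : ℝ) * a k l (m - j) * f l j)).re)
    (P : Fin d → (ι → ℤ) → ℝ) (F : Finset (ι → ℤ)) (x : (ι → ℤ) → ℂ)
    (hx : ∀ m ∈ F, (τ : ℂ) ^ 2 * x m
      + ∑ k, (P k m : ℂ) * ∑ l, ∑ j ∈ F, a k l (m - j) * (P l j * x j)
      = ∑ k, Complex.I * P k m * b k m) :
    ∀ m ∈ F,
      (∀ k, ‖P k m * x m‖ ≤ 2 * (d * B * ∑' q : ι → ℤ, Real.exp (-((σ - s) * latNorm q))) / lam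
        * Real.exp (-(s * latNorm m))) ∧
      |τ| * ‖x m‖ ≤ 2 * (d * B * ∑' q : ι → ℤ, Real.exp (-((σ - s) * latNorm q))) / lam
        * Real.exp (-(s * latNorm m)) := by
  classical
  set w : (ι → ℤ) → ℝ := fun m => Real.exp (s * latNorm m) with hw
  have hw0 : ∀ m, 0 < w m := fun m => Real.exp_pos _
  set y : (ι → ℤ) → ℂ := fun m => w m * x m with hy
  set f : Fin d → (ι → ℤ) → ℂ := fun k m => P k m * y m with hf
  set S : ℝ := ∑ k, ∑ m ∈ F, ‖f k m‖ ^ 2 with hS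
  set G : ℝ := ∑ m ∈ F, ‖y m‖ ^ 2 with hG
  set Z : ℝ := ∑' q : ι → ℤ, Real.exp (-((σ - s) * latNorm q)) with hZ
  have hZ0 : 0 ≤ Z := tsum_nonneg fun _ => (Real.exp_pos _).le
  have hS0 : 0 ≤ S := Finset.sum_nonneg fun _ _ => Finset.sum_nonneg fun _ _ => sq_nonneg _
  have hG0 : 0 ≤ G := Finset.sum_nonneg fun _ _ => sq_nonneg _
  have hid : (τ : ℂ) ^ 2 * (G : ℂ) + ∑ k, ∑ l, ∑ m ∈ F, ∑ j ∈ F, conj (f k m) *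
          ((Real.exp (s * (latNorm m - latNorm j)) : ℝ) * a k l (m - j) * f l j)
      = ∑ m ∈ F, ∑ k, Complex.I * b k m * w m * conj (f k m) := by
    have h1 : ∀ m ∈ F, (τ : ℂ) ^ 2 * (‖y m‖ ^ 2 : ℝ) + ∑ k, ∑ l, ∑ j ∈ F, conj (f k m) *
          ((Real.exp (s * (latNorm m - latNorm j)) : ℝ) * a k l (m - j) * f l j)
        = ∑ k, Complex.I * b k m * w m * conj (f k m) := by
      intro m hm
      have h2 := congrArg (fun z => w m * conj (y m) * z) (hx m hm)
      simp only [mul_add, Finset.mul_sum] at h2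
      convert h2 using 1
      · congr 1
        · rw [Complex.ofReal_pow, ← Complex.mul_conj']
          simp only [hy]; ring
        · refine Finset.sum_congr rfl fun k _ => Finset.sum_congr rfl fun l _ =>
            Finset.sum_congr rfl fun j _ => ?_
          have hexp : Real.exp (s * (latNorm m - latNorm j)) * w j = w m := by
            simp only [hw]; rw [← Real.exp_add]; congr 1; ring
          simp only [hf, map_mul, Complex.conj_ofReal]
          rw [← hexp]
          simp only [hy]
          push_cast
          ring
      · refine Finset.sum_congr rfl fun k _ => ?_
        simp only [hf, map_mul, Complex.conj_ofReal]
        ring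
    rw [← Finset.sum_congr rfl h1, Finset.sum_add_distrib, hG]
    congr 1
    · rw [Complex.ofReal_sum, Finset.mul_sum]
    · rw [Finset.sum_comm' (t' := Finset.univ) (s' := fun _ => F) (by simp)]
      refine Finset.sum_congr rfl fun k _ => ?_
      rw [Finset.sum_comm]
  have hfle : ∀ k, ∀ m ∈ F, ‖f k m‖ ≤ √S := by
    intro k m hm
    refine Real.le_sqrt_of_sq_le ?_
    calc ‖f k m‖ ^ 2 ≤ ∑ m ∈ F, ‖f k m‖ ^ 2 :=
          Finset.single_le_sum (f := fun m => ‖f k m‖ ^ 2) (fun _ _ => sq_nonneg _) hm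
      _ ≤ S := Finset.single_le_sum (f := fun k => ∑ m ∈ F, ‖f k m‖ ^ 2)
          (fun _ _ => Finset.sum_nonneg fun _ _ => sq_nonneg _) (Finset.mem_univ k)
  have hrhs : ‖∑ m ∈ F, ∑ k, Complex.I * b k m * w m * conj (f k m)‖ ≤ d * B * Z * √S := by
    calc _ ≤ ∑ m ∈ F, ∑ _k : Fin d, B * Real.exp (-((σ - s) * latNorm m)) * √S := by
          refine (norm_sum_le _ _).trans (Finset.sum_le_sum fun m hm => ?_)
          refine (norm_sum_le _ _).trans (Finset.sum_le_sum fun k _ => ?_)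
          rw [norm_mul, norm_mul, norm_mul, Complex.norm_I, one_mul, RCLike.norm_conj,
            Complex.norm_real, Real.norm_of_nonneg (hw0 m).le]
          have h3 : Real.exp (-((σ - s) * latNorm m)) = Real.exp (-(σ * latNorm m)) * w m := by
            simp only [hw]; rw [← Real.exp_add]; congr 1; ring
          rw [h3, ← mul_assoc B]
          gcongr
          · exact hb k m
          · exact hfle k m hm
      _ = d * B * (∑ m ∈ F, Real.exp (-((σ - s) * latNorm m))) * √S := by
          simp only [Finset.sum_const, Finset.card_univ, Fintype.card_fin, nsmul_eq_mul,
            ← Finset.mul_sum, ← Finset.sum_mul]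
          ring
      _ ≤ _ := by
          have h4 : ∑ m ∈ F, Real.exp (-((σ - s) * latNorm m)) ≤ Z :=
            (summable_exp_latNorm (sub_pos.mpr hsσ)).sum_le_tsum _
              fun _ _ => (Real.exp_pos _).le
          exact mul_le_mul_of_nonneg_right
            (mul_le_mul_of_nonneg_left h4 (mul_nonneg (Nat.cast_nonneg d) hB)) (Real.sqrt_nonneg S)
  have henergy : τ ^ 2 * G + lam / 2 * S ≤ d * B * Z * √S := by
    have h1 := congrArg Complex.re hid
    rw [Complex.add_re] at h1
    have h2 : ((τ : ℂ) ^ 2 * (G : ℂ)).re = τ ^ 2 * G := by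
      rw [← Complex.ofReal_pow, ← Complex.ofReal_mul, Complex.ofReal_re]
    have h3 := hcoer F f
    have h4 := (Complex.re_le_norm _).trans hrhs
    linarith
  set D : ℝ := d * B * Z with hD
  have hD0 : 0 ≤ D := mul_nonneg (mul_nonneg (Nat.cast_nonneg d) hB) hZ0
  obtain ⟨hSle, hGle⟩ := energy_absorb hlam hlam1 hD0 hS0 (mul_nonneg (sq_nonneg τ) hG0) henergy
  intro m hm
  have hinv : Real.exp (-(s * latNorm m)) = (w m)⁻¹ := by rw [Real.exp_neg]
  rw [hinv, ← div_eq_mul_inv]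
  constructor
  · intro k
    rw [le_div_iff₀ (hw0 m)]
    refine le_trans (le_of_eq ?_) ((hfle k m hm).trans hSle)
    simp only [hf, hy, norm_mul, Complex.norm_real, Real.norm_of_nonneg (hw0 m).le]
    ring
  · rw [le_div_iff₀ (hw0 m)]
    have hyG : ‖y m‖ ^ 2 ≤ G :=
      Finset.single_le_sum (f := fun m => ‖y m‖ ^ 2) (fun _ _ => sq_nonneg _) hm
    have h1 : |τ| * ‖x m‖ * w m = |τ| * ‖y m‖ := by
      simp only [hy, norm_mul, Complex.norm_real, Real.norm_of_nonneg (hw0 m).le]; ring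
    rw [h1]
    refine (pow_le_pow_iff_left₀ (by positivity) (by positivity) two_ne_zero).mp ?_
    rw [mul_pow, sq_abs]
    exact (mul_le_mul_of_nonneg_left hyG (sq_nonneg _)).trans hGle

/-- The truncated system is solvable. -/
lemma galerkin_exists {a : Fin d → Fin d → (ι → ℤ) → ℂ}
    {s lam τ : ℝ} (hlam : 0 < lam) (hlam1 : lam ≤ 1) (hτ : 0 < τ)
    (hcoer : ∀ (F : Finset (ι → ℤ)) (f : Fin d → (ι → ℤ) → ℂ),
      lam / 2 * ∑ k, ∑ m ∈ F, ‖f k m‖ ^ 2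
      ≤ (∑ k, ∑ l, ∑ m ∈ F, ∑ j ∈ F, conj (f k m) *
          ((Real.exp (s * (latNorm m - latNorm j)) : ℝ) * a k l (m - j) * f l j)).re)
    (P : Fin d → (ι → ℤ) → ℝ) (F : Finset (ι → ℤ)) (g : (ι → ℤ) → ℂ) :
    ∃ x : (ι → ℤ) → ℂ, (∀ m ∉ F, x m = 0) ∧ ∀ m ∈ F, (τ : ℂ) ^ 2 * x m
      + ∑ k, (P k m : ℂ) * ∑ l, ∑ j ∈ F, a k l (m - j) * (P l j * x j) = g m := by
  classical
  let T : (F → ℂ) →ₗ[ℂ] (F → ℂ) :=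
    { toFun := fun x m => (τ : ℂ) ^ 2 * x m
        + ∑ k, (P k m : ℂ) * ∑ l, ∑ j : F, a k l (m - j) * (P l j * x j)
      map_add' := fun x x' => by
        funext m
        simp only [Pi.add_apply, mul_add, Finset.sum_add_distrib]
        ring
      map_smul' := fun c x => by
        funext m
        simp only [Pi.smul_apply, smul_eq_mul, RingHom.id_apply, mul_add, Finset.mul_sum]
        congr 1
        · ring
        · refine Finset.sum_congr rfl fun k _ => Finset.sum_congr rfl fun l _ =>
            Finset.sum_congr rfl fun j _ => ?_
          ring }
  let ext : (F → ℂ) → (ι → ℤ) → ℂ := fun x m => if h : m ∈ F then x ⟨m, h⟩ else 0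
  have hext : ∀ (x : F → ℂ) (m : F), ext x m = x m := fun x m => by simp [ext]
  have hT : ∀ (x : F → ℂ) (m : F), T x m = (τ : ℂ) ^ 2 * ext x m
      + ∑ k, (P k m : ℂ) * ∑ l, ∑ j ∈ F, a k l (m - j) * (P l j * ext x j) := by
    intro x m
    rw [hext]
    change (τ : ℂ) ^ 2 * x m + _ = _
    congr 1
    refine Finset.sum_congr rfl fun k _ => ?_
    congr 1
    refine Finset.sum_congr rfl fun l _ => ?_
    rw [← Finset.sum_coe_sort F]
    refine Finset.sum_congr rfl fun j _ => ?_
    rw [hext]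
  have hinj : Function.Injective T := by
    rw [← LinearMap.ker_eq_bot, LinearMap.ker_eq_bot']
    intro x hx
    funext m
    have hb := galerkin_bound (b := fun _ _ => 0) (B := 0) (τ := τ) (lt_add_one s) hlam hlam1
      le_rfl (by simp) hcoer P F (ext x) (fun m hm => by
        rw [← hT x ⟨m, hm⟩, hx]; simp) m m.2
    have h2 := hb.2
    rw [hext, abs_of_pos hτ] at h2
    have h3 : τ * ‖x m‖ ≤ 0 := by simpa using h2
    have h4 : ‖x m‖ ≤ 0 := by
      by_contra! h
      nlinarith [mul_pos hτ h]
    simpa using h4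
  obtain ⟨x, hx⟩ := LinearMap.injective_iff_surjective.mp hinj (fun m => g m)
  refine ⟨ext x, fun m hm => by simp [ext, hm], fun m hm => ?_⟩
  rw [← hT x ⟨m, hm⟩, hx]

end Galerkin

section Limit

open scoped ComplexConjugate
open Filter Topology

variable {ι : Type*} [Fintype ι] {d : ℕ}

/-- Existence of an exponentially decaying solution of a coercive convolution system. -/
theorem exists_convolution_solution {a : Fin d → Fin d → (ι → ℤ) → ℂ}
    {b : Fin d → (ι → ℤ) → ℂ} {K σ s lam τ B : ℝ} (hs : 0 < s) (hsσ : s < σ)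
    (hlam : 0 < lam) (hlam1 : lam ≤ 1) (hτ : 0 < τ) (hK : 0 ≤ K) (hB : 0 ≤ B)
    (ha : ∀ k l m, ‖a k l m‖ ≤ K * Real.exp (-(σ * latNorm m)))
    (hb : ∀ k m, ‖b k m‖ ≤ B * Real.exp (-(σ * latNorm m)))
    (hsmall : d * ∑' m : ι → ℤ,
      K * (Real.exp (-(σ * latNorm m)) * (Real.exp (s * latNorm m) - 1)) ≤ lam / 2)
    (hcoer : ∀ (F : Finset (ι → ℤ)) (f : Fin d → (ι → ℤ) → ℂ),
      lam * ∑ k, ∑ m ∈ F, ‖f k m‖ ^ 2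
        ≤ (∑ k, ∑ l, ∑ m ∈ F, ∑ j ∈ F, conj (f k m) * (a k l (m - j) * f l j)).re)
    (P : Fin d → (ι → ℤ) → ℝ) :
    ∃ x : (ι → ℤ) → ℂ,
      (∀ m, (τ : ℂ) ^ 2 * x m
        + ∑ k, (P k m : ℂ) * ∑ l, ∑' j, a k l (m - j) * (P l j * x j)
        = ∑ k, Complex.I * P k m * b k m) ∧
      (∀ m k, ‖P k m * x m‖ ≤
        2 * (d * B * ∑' q : ι → ℤ, Real.exp (-((σ - s) * latNorm q))) / lam
          * Real.exp (-(s * latNorm m))) ∧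
      ∀ m, τ * ‖x m‖ ≤ 2 * (d * B * ∑' q : ι → ℤ, Real.exp (-((σ - s) * latNorm q))) / lam
          * Real.exp (-(s * latNorm m)) := by
  classical
  have hcw := weighted_coercive hs hsσ hK ha hsmall hcoer
  set D : ℝ := 2 * (d * B * ∑' q : ι → ℤ, Real.exp (-((σ - s) * latNorm q))) / lam with hD
  have hD0 : 0 ≤ D := by
    have : 0 ≤ ∑' q : ι → ℤ, Real.exp (-((σ - s) * latNorm q)) :=
      tsum_nonneg fun _ => (Real.exp_pos _).le
    positivity
  choose X hX0 hX using fun F : Finset (ι → ℤ) =>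
    galerkin_exists hlam hlam1 hτ hcw P F (fun m => ∑ k, Complex.I * P k m * b k m)
  have hbd : ∀ F m, (∀ k, ‖P k m * X F m‖ ≤ D * Real.exp (-(s * latNorm m))) ∧
      τ * ‖X F m‖ ≤ D * Real.exp (-(s * latNorm m)) := by
    intro F m
    by_cases hm : m ∈ F
    · have := galerkin_bound hsσ hlam hlam1 hB hb hcw P F (X F) (hX F) m hm
      rwa [abs_of_pos hτ] at this
    · rw [hX0 F m hm]
      simp only [mul_zero, norm_zero]
      have : 0 ≤ D * Real.exp (-(s * latNorm m)) := mul_nonneg hD0 (Real.exp_pos _).le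
      exact ⟨fun _ => this, this⟩
  let U : Ultrafilter (Finset (ι → ℤ)) := Ultrafilter.of atTop
  have hU : (U : Filter (Finset (ι → ℤ))) ≤ atTop := Ultrafilter.of_le _
  have hcomp : IsCompact (Set.univ.pi fun _m : ι → ℤ => Metric.closedBall (0 : ℂ) (D / τ)) :=
    isCompact_univ_pi fun _ => isCompact_closedBall _ _
  obtain ⟨x, -, hx⟩ := hcomp.ultrafilter_le_nhds (U.map X) (by
    rw [Filter.le_principal_iff]
    refine Filter.mem_map.mpr (Filter.univ_mem' fun F => ?_)
    refine fun m _ => ?_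
    rw [mem_closedBall_zero_iff, le_div_iff₀ hτ, mul_comm]
    refine (hbd F m).2.trans (mul_le_of_le_one_right hD0 ?_)
    exact Real.exp_le_one_iff.mpr (neg_nonpos.mpr (mul_nonneg hs.le (latNorm_nonneg m))))
  have hlim : ∀ m, Tendsto (fun F => X F m) U (𝓝 (x m)) := tendsto_pi_nhds.mp hx
  refine ⟨x, fun m => ?_, fun m k => ?_, fun m => ?_⟩
  · have hterm : ∀ k l : Fin d, Tendsto (fun F => ∑ j ∈ F, a k l (m - j) * (P l j * X F j)) U
        (𝓝 (∑' j, a k l (m - j) * (P l j * x j))) := by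
      intro k l
      have h1 : (fun F : Finset (ι → ℤ) => ∑ j ∈ F, a k l (m - j) * (P l j * X F j))
          = fun F => ∑' j, a k l (m - j) * (P l j * X F j) := by
        funext F
        rw [tsum_eq_sum]
        intro j hj
        rw [hX0 F j hj]; simp
      rw [h1]
      refine tendsto_tsum_of_dominated_convergence
        (bound := fun j => K * Real.exp (-(σ * latNorm (m - j))) * D) ?_ (fun j => ?_) ?_
      · refine Summable.mul_right _ (Summable.mul_left _ ?_)
        exact (Equiv.subLeft m).summable_iff.mpr (summable_exp_latNorm (hs.trans hsσ))
      · exact ((hlim j).const_mul _).const_mul _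
      · refine Eventually.of_forall fun F j => ?_
        rw [norm_mul]
        refine mul_le_mul (ha k l _) (((hbd F j).1 l).trans ?_) (norm_nonneg _)
          (mul_nonneg hK (Real.exp_pos _).le)
        refine mul_le_of_le_one_right hD0 ?_
        exact Real.exp_le_one_iff.mpr (neg_nonpos.mpr (mul_nonneg hs.le (latNorm_nonneg j)))
    have hlhs : Tendsto (fun F => (τ : ℂ) ^ 2 * X F m
        + ∑ k, (P k m : ℂ) * ∑ l, ∑ j ∈ F, a k l (m - j) * (P l j * X F j)) U
        (𝓝 ((τ : ℂ) ^ 2 * x m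
          + ∑ k, (P k m : ℂ) * ∑ l, ∑' j, a k l (m - j) * (P l j * x j))) :=
      ((hlim m).const_mul _).add (tendsto_finsetSum _ fun k _ =>
        (tendsto_finsetSum _ fun l _ => hterm k l).const_mul _)
    refine tendsto_nhds_unique hlhs ?_
    refine tendsto_const_nhds.congr' ?_
    have hmem : ∀ᶠ F in (U : Filter (Finset (ι → ℤ))), m ∈ F :=
      hU ((eventually_ge_atTop {m}).mono fun F hF => Finset.singleton_subset_iff.mp hF)
    filter_upwards [hmem] with F hF
    exact (hX F m hF).symm
  · exact le_of_tendsto ((hlim m).const_mul _).norm (Eventually.of_forall fun F => (hbd F m).1 k)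
  · exact le_of_tendsto ((hlim m).norm.const_mul _) (Eventually.of_forall fun F => (hbd F m).2)

end Limit

/-! ### Trigonometric series with exponentially decaying coefficients -/

section TrigSeries

open scoped ContDiff

variable {d n : ℕ}

/-- Frequencies dual to `(ℝ^d)^n`. -/
abbrev Freq (d n : ℕ) := Fin n × Fin d → ℤ

/-- The phase `2π m · y` as a linear functional. -/
def phase (m : Freq d n) : Dom d n →L[ℝ] ℝ :=
  ∑ p : Fin n × Fin d, (2 * π * (m p : ℝ)) •
    (ContinuousLinearMap.proj (R := ℝ) (φ := fun _ : Fin d => ℝ) p.2).comp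
      (ContinuousLinearMap.proj (R := ℝ) (φ := fun _ : Fin n => Fin d → ℝ) p.1)

lemma phase_apply (m : Freq d n) (y : Dom d n) :
    phase m y = ∑ p : Fin n × Fin d, 2 * π * (m p : ℝ) * y p.1 p.2 := by
  simp [phase]

lemma phase_add (m q : Freq d n) (y : Dom d n) : phase (m + q) y = phase m y + phase q y := by
  simp only [phase_apply, ← Finset.sum_add_distrib]
  refine Finset.sum_congr rfl fun p _ => ?_
  push_cast [Pi.add_apply]; ring

lemma norm_phase_le (m : Freq d n) : ‖phase m‖ ≤ 2 * π * latNorm m := by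
  refine ContinuousLinearMap.opNorm_le_bound _
    (mul_nonneg (by positivity) (latNorm_nonneg m)) fun y => ?_
  rw [phase_apply, latNorm, Finset.mul_sum, Finset.sum_mul]
  refine (norm_sum_le _ _).trans (Finset.sum_le_sum fun p _ => ?_)
  rw [norm_mul, norm_mul, Real.norm_eq_abs (m p : ℝ), Real.norm_of_nonneg (by positivity)]
  gcongr
  exact (norm_le_pi_norm (y p.1) p.2).trans (norm_le_pi_norm y p.1)

/-- The character `exp(2πi m · y)`. -/
def chr (m : Freq d n) (y : Dom d n) : ℂ := Complex.exp (phase m y * Complex.I)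

lemma norm_chr (m : Freq d n) (y : Dom d n) : ‖chr m y‖ = 1 :=
  Complex.norm_exp_ofReal_mul_I _

lemma chr_add (m q : Freq d n) (y : Dom d n) : chr (m + q) y = chr m y * chr q y := by
  rw [chr, chr, chr, ← Complex.exp_add, phase_add]
  push_cast; ring_nf

lemma chr_translate (m : Freq d n) (y : Dom d n) (z : Fin n → Fin d → ℤ) :
    chr m (fun i k => y i k + (z i k : ℝ)) = chr m y := by
  rw [chr, chr, Complex.exp_eq_exp_iff_exists_int]
  refine ⟨∑ p : Fin n × Fin d, m p * z p.1 p.2, ?_⟩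
  simp only [phase_apply]
  push_cast
  simp only [Finset.sum_mul, ← Finset.sum_add_distrib]
  refine Finset.sum_congr rfl fun p _ => ?_
  ring

lemma contDiff_chr (m : Freq d n) : ContDiff ℝ ∞ (chr m) := by
  unfold chr
  exact (Complex.ofRealCLM.contDiff.comp (phase m).contDiff).mul contDiff_const |>.cexp

lemma hasFDerivAt_chr (m : Freq d n) (y : Dom d n) :
    HasFDerivAt (chr m) ((Complex.I * chr m y) • (Complex.ofRealCLM.comp (phase m))) y := by
  have h := ((Complex.ofRealCLM.hasFDerivAt.comp y (phase m).hasFDerivAt).mul_const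
    Complex.I).cexp
  convert! h using 1
  ext v
  simp [chr]
  ring

lemma iteratedDeriv_cexp_mul_I (l : ℕ) :
    iteratedDeriv l (fun t : ℝ => Complex.exp (t * Complex.I))
      = fun t : ℝ => Complex.I ^ l * Complex.exp (t * Complex.I) := by
  induction l with
  | zero => simp
  | succ l ih =>
    rw [iteratedDeriv_succ, ih]
    funext t
    have h : HasDerivAt (fun t : ℝ => Complex.exp (t * Complex.I))
        (Complex.exp (t * Complex.I) * (1 * Complex.I)) t :=
      ((Complex.ofRealCLM.hasDerivAt (x := t)).mul_const Complex.I).cexp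
    rw [(h.const_mul _).deriv]
    ring

lemma norm_iteratedFDeriv_chr_le (l : ℕ) (m : Freq d n) (y : Dom d n) :
    ‖iteratedFDeriv ℝ l (chr m) y‖ ≤ (2 * π * latNorm m) ^ l := by
  have hsm : ContDiff ℝ ∞ (fun t : ℝ => Complex.exp (t * Complex.I)) :=
    (Complex.ofRealCLM.contDiff.mul contDiff_const).cexp
  have h := (phase m).iteratedFDeriv_comp_right hsm y (i := l) (by exact_mod_cast le_top)
  have h2 : (fun t : ℝ => Complex.exp (t * Complex.I)) ∘ phase m = chr m := rfl
  rw [h2] at h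
  rw [h]
  refine (ContinuousMultilinearMap.norm_compContinuousLinearMap_le _ _).trans ?_
  rw [norm_iteratedFDeriv_eq_norm_iteratedDeriv, iteratedDeriv_cexp_mul_I, norm_mul, norm_pow,
    Complex.norm_I, one_pow, Complex.norm_exp_ofReal_mul_I, one_mul, one_mul, Finset.prod_const,
    Finset.card_univ, Fintype.card_fin]
  exact pow_le_pow_left₀ (norm_nonneg _) (norm_phase_le m) l

/-- The trigonometric series with coefficients `c`. -/
def trig (c : Freq d n → ℂ) (y : Dom d n) : ℂ := ∑' m, c m * chr m y

/-- Exponential decay of a lattice sequence. -/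
def ExpDecay (K a : ℝ) (c : Freq d n → ℂ) : Prop :=
  ∀ m, ‖c m‖ ≤ K * Real.exp (-(a * latNorm m))

/-- The total mass `∑ exp(-a|m|)` over the frequency lattice. -/
def expMass (d n : ℕ) (a : ℝ) : ℝ := ∑' m : Freq d n, Real.exp (-(a * latNorm m))

lemma one_le_expMass {a : ℝ} (ha : 0 < a) : 1 ≤ expMass d n a := by
  have h := (summable_exp_latNorm (ι := Fin n × Fin d) ha).sum_le_tsum {0}
    fun _ _ => (Real.exp_pos _).le
  rw [Finset.sum_singleton, latNorm_zero, mul_zero, neg_zero, Real.exp_zero] at h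
  exact h

lemma pow_mul_exp_le {a t : ℝ} (ha : 0 < a) (ht : 0 ≤ t) (l : ℕ) :
    (2 * π * t) ^ l * Real.exp (-(a * t))
      ≤ (4 * π / a) ^ l * l.factorial * Real.exp (-(a / 2 * t)) := by
  have h := Real.pow_div_factorial_le_exp (a / 2 * t) (by positivity) l
  rw [div_le_iff₀ (by positivity)] at h
  have h1 : (2 * π * t) ^ l = (4 * π / a) ^ l * (a / 2 * t) ^ l := by
    rw [← mul_pow]; congr 1; field_simp; ring
  have h2 : Real.exp (-(a * t)) = Real.exp (-(a / 2 * t)) * Real.exp (-(a / 2 * t)) := by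
    rw [← Real.exp_add]; congr 1; ring
  have h3 : Real.exp (a / 2 * t) * Real.exp (-(a / 2 * t)) = 1 := by
    rw [← Real.exp_add]; simp
  calc (2 * π * t) ^ l * Real.exp (-(a * t))
      = (4 * π / a) ^ l * ((a / 2 * t) ^ l) * Real.exp (-(a / 2 * t))
          * Real.exp (-(a / 2 * t)) := by rw [h1, h2]; ring
    _ ≤ (4 * π / a) ^ l * (Real.exp (a / 2 * t) * l.factorial) * Real.exp (-(a / 2 * t))
          * Real.exp (-(a / 2 * t)) := by gcongr
    _ = (4 * π / a) ^ l * l.factorial * Real.exp (-(a / 2 * t))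
          * (Real.exp (a / 2 * t) * Real.exp (-(a / 2 * t))) := by ring
    _ = _ := by rw [h3, mul_one]

namespace ExpDecay

variable {K a : ℝ} {c : Freq d n → ℂ}

lemma const_nonneg (hc : ExpDecay K a c) : 0 ≤ K := by
  have h := (norm_nonneg _).trans (hc 0)
  exact nonneg_of_mul_nonneg_left h (Real.exp_pos _)

lemma norm_iteratedFDeriv_term_le (hc : ExpDecay K a c) (ha : 0 < a) (l : ℕ) (m : Freq d n)
    (y : Dom d n) : ‖iteratedFDeriv ℝ l (fun y => c m * chr m y) y‖
      ≤ K * ((4 * π / a) ^ l * l.factorial * Real.exp (-(a / 2 * latNorm m))) := by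
  have h1 : (fun y => c m * chr m y) = c m • chr m := rfl
  rw [h1, iteratedFDeriv_const_smul_apply
    ((contDiff_chr m).contDiffAt.of_le (by exact_mod_cast le_top)), norm_smul]
  calc ‖c m‖ * ‖iteratedFDeriv ℝ l (chr m) y‖
      ≤ K * Real.exp (-(a * latNorm m)) * (2 * π * latNorm m) ^ l :=
        mul_le_mul (hc m) (norm_iteratedFDeriv_chr_le l m y) (norm_nonneg _)
          (mul_nonneg hc.const_nonneg (Real.exp_pos _).le)
    _ = K * ((2 * π * latNorm m) ^ l * Real.exp (-(a * latNorm m))) := by ring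
    _ ≤ _ := mul_le_mul_of_nonneg_left (pow_mul_exp_le ha (latNorm_nonneg m) l) hc.const_nonneg

lemma summable_bound (K : ℝ) (ha : 0 < a) (l : ℕ) : Summable fun m : Freq d n =>
    K * ((4 * π / a) ^ l * l.factorial * Real.exp (-(a / 2 * latNorm m))) :=
  ((summable_exp_latNorm (half_pos ha)).mul_left _).mul_left _

lemma summable_norm (hc : ExpDecay K a c) (ha : 0 < a) : Summable fun m => ‖c m‖ :=
  Summable.of_nonneg_of_le (fun _ => norm_nonneg _) hc ((summable_exp_latNorm ha).mul_left K)

lemma summable (hc : ExpDecay K a c) (ha : 0 < a) (y : Dom d n) :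
    Summable fun m => c m * chr m y := by
  refine Summable.of_norm ((hc.summable_norm ha).congr fun m => ?_)
  rw [norm_mul, norm_chr, mul_one]

lemma norm_trig_le (hc : ExpDecay K a c) (ha : 0 < a) (y : Dom d n) :
    ‖trig c y‖ ≤ K * expMass d n a := by
  rw [expMass, ← tsum_mul_left]
  refine tsum_of_norm_bounded ((summable_exp_latNorm ha).mul_left K).hasSum fun m => ?_
  rw [norm_mul, norm_chr, mul_one]
  exact hc m

lemma contDiff_trig (hc : ExpDecay K a c) (ha : 0 < a) : ContDiff ℝ ∞ (trig c) :=
  contDiff_tsum (N := (⊤ : ℕ∞)) (fun m => contDiff_const.mul (contDiff_chr m))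
    (fun l _ => summable_bound K ha l)
    fun l m y _ => hc.norm_iteratedFDeriv_term_le ha l m y

lemma norm_iteratedFDeriv_trig_le (hc : ExpDecay K a c) (ha : 0 < a) (l : ℕ) (y : Dom d n) :
    ‖iteratedFDeriv ℝ l (trig c) y‖
      ≤ K * ((4 * π / a) ^ l * l.factorial * expMass d n (a / 2)) := by
  unfold trig
  rw [iteratedFDeriv_tsum_apply (N := (⊤ : ℕ∞))
    (fun m => contDiff_const.mul (contDiff_chr m))
    (fun l _ => summable_bound K ha l)
    (fun l m y _ => hc.norm_iteratedFDeriv_term_le ha l m y) le_top]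
  rw [expMass, ← tsum_mul_left, ← tsum_mul_left]
  exact tsum_of_norm_bounded (summable_bound K ha l).hasSum
    fun m => hc.norm_iteratedFDeriv_term_le ha l m y

lemma fderiv_trig_re (hc : ExpDecay K a c) (ha : 0 < a) (y v : Dom d n) :
    fderiv ℝ (fun y => (trig c y).re) y v
      = (trig (fun m => Complex.I * phase m v * c m) y).re := by
  have hf : ∀ m (y : Dom d n), HasFDerivAt (fun y => c m * chr m y)
      (c m • ((Complex.I * chr m y) • (Complex.ofRealCLM.comp (phase m)))) y :=
    fun m y => (hasFDerivAt_chr m y).const_mul (c m)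
  have hb : ∀ m (y : Dom d n),
      ‖c m • ((Complex.I * chr m y) • (Complex.ofRealCLM.comp (phase m)))‖
      ≤ K * ((4 * π / a) ^ 1 * (Nat.factorial 1) * Real.exp (-(a / 2 * latNorm m))) := by
    intro m y
    have h1 := hc.norm_iteratedFDeriv_term_le ha 1 m y
    rwa [norm_iteratedFDeriv_one, (hf m y).fderiv] at h1
  have h := hasFDerivAt_tsum (summable_bound K ha 1) hf hb (hc.summable ha y) y
  have h2 : HasFDerivAt (fun y => (trig c y).re) _ y := Complex.reCLM.hasFDerivAt.comp y h
  rw [h2.fderiv, ContinuousLinearMap.comp_apply, Complex.reCLM_apply]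
  congr 1
  have hsum : Summable fun m => c m • ((Complex.I * chr m y) •
      (Complex.ofRealCLM.comp (phase m))) :=
    Summable.of_norm_bounded (summable_bound K ha 1) fun m => hb m y
  have h3 := ((ContinuousLinearMap.apply ℝ ℂ v).hasSum hsum.hasSum).tsum_eq
  rw [ContinuousLinearMap.apply_apply] at h3
  rw [← h3, trig]
  refine tsum_congr fun m => ?_
  simp
  ring

end ExpDecay

lemma trig_translate (c : Freq d n → ℂ) : ∀ (y : Dom d n) (z : Fin n → Fin d → ℤ),
    trig c (fun i k => y i k + (z i k : ℝ)) = trig c y := by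
  intro y z
  simp only [trig, chr_translate]

end TrigSeries

section Convolution

variable {d n : ℕ}

/-- Convolution of lattice sequences. -/
def latConv (α c : Freq d n → ℂ) (m : Freq d n) : ℂ := ∑' j, α (m - j) * c j

lemma exp_conv_le {σ s : ℝ} (hs : 0 ≤ s) (m j : Freq d n) :
    Real.exp (-(σ * latNorm (m - j))) * Real.exp (-(s * latNorm j))
      ≤ Real.exp (-(s * latNorm m)) * Real.exp (-((σ - s) * latNorm (m - j))) := by
  rw [← Real.exp_add, ← Real.exp_add]
  refine Real.exp_le_exp.mpr ?_
  have h := latNorm_add_le (m - j) j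
  rw [sub_add_cancel] at h
  nlinarith

lemma ExpDecay.latConv {α c : Freq d n → ℂ} {K C σ s : ℝ} (hα : ExpDecay K σ α)
    (hc : ExpDecay C s c) (hs : 0 ≤ s) (hsσ : s < σ) :
    ExpDecay (K * C * expMass d n (σ - s)) s (latConv α c) := by
  intro m
  have hsum : Summable fun j : Freq d n => Real.exp (-((σ - s) * latNorm (m - j))) :=
    (Equiv.subLeft m).summable_iff.mpr (summable_exp_latNorm (sub_pos.mpr hsσ))
  have htot : ∑' j : Freq d n, Real.exp (-((σ - s) * latNorm (m - j))) = expMass d n (σ - s) :=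
    (Equiv.subLeft m).tsum_eq fun q : Freq d n => Real.exp (-((σ - s) * latNorm q))
  have h := tsum_of_norm_bounded (f := fun j => α (m - j) * c j)
    (hsum.mul_left (K * C * Real.exp (-(s * latNorm m)))).hasSum fun j => by
      rw [norm_mul]
      calc ‖α (m - j)‖ * ‖c j‖
          ≤ (K * Real.exp (-(σ * latNorm (m - j)))) * (C * Real.exp (-(s * latNorm j))) :=
            mul_le_mul (hα _) (hc _) (norm_nonneg _)
              (mul_nonneg hα.const_nonneg (Real.exp_pos _).le)
        _ = K * C * (Real.exp (-(σ * latNorm (m - j))) * Real.exp (-(s * latNorm j))) := by ring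
        _ ≤ K * C * (Real.exp (-(s * latNorm m)) * Real.exp (-((σ - s) * latNorm (m - j)))) :=
            mul_le_mul_of_nonneg_left (exp_conv_le hs m j)
              (mul_nonneg hα.const_nonneg hc.const_nonneg)
        _ = _ := by ring
  rw [tsum_mul_left, htot] at h
  refine h.trans (le_of_eq ?_)
  ring

lemma trig_mul {α c : Freq d n → ℂ} {K C σ s : ℝ} (hα : ExpDecay K σ α) (hσ : 0 < σ)
    (hc : ExpDecay C s c) (hs : 0 < s) (y : Dom d n) :
    trig α y * trig c y = trig (latConv α c) y := by
  have hn : ∀ {K a : ℝ} {c : Freq d n → ℂ}, ExpDecay K a c → 0 < a →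
      Summable fun m => ‖c m * chr m y‖ := fun hc ha =>
    (hc.summable_norm ha).congr fun m => by rw [norm_mul, norm_chr, mul_one]
  have hsum := summable_mul_of_summable_norm (hn hα hσ) (hn hc hs)
  let e : Freq d n × Freq d n ≃ Freq d n × Freq d n :=
    { toFun := fun z => (z.1 - z.2, z.2)
      invFun := fun z => (z.1 + z.2, z.2)
      left_inv := fun z => by simp
      right_inv := fun z => by simp }
  have hsum2 : Summable fun z => α (e z).1 * chr (e z).1 y * (c (e z).2 * chr (e z).2 y) :=
    e.summable_iff.mpr hsum
  rw [trig, trig, tsum_mul_tsum_of_summable_norm (hn hα hσ) (hn hc hs), ← e.tsum_eq,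
    hsum2.tsum_prod, trig]
  refine tsum_congr fun m => ?_
  rw [latConv, ← tsum_mul_right]
  refine tsum_congr fun j => ?_
  have h : chr m y = chr (m - j) y * chr j y := by rw [← chr_add, sub_add_cancel]
  rw [h]
  simp only [e, Equiv.coe_fn_mk]
  ring

end Convolution

/-! ### Averages of multiperiodic functions -/

section Torus

open scoped ContDiff ComplexConjugate
open Topology Filter

variable {d n : ℕ}

/-- Projection of `(ℝ^d)^n` onto the torus. -/
def toTorus (y : Dom d n) : UnitAddTorus (Fin n × Fin d) := fun p => (y p.1 p.2 : UnitAddCircle)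

/-- A representative of a point of the torus. -/
def repr (t : UnitAddTorus (Fin n × Fin d)) : Dom d n := fun i k => Quotient.out (t (i, k))

lemma toTorus_repr (t : UnitAddTorus (Fin n × Fin d)) : toTorus (repr t) = t := by
  funext p
  exact Quotient.out_eq (t p)

lemma toTorus_add (y z : Dom d n) : toTorus (y + z) = toTorus y + toTorus z := rfl

lemma isOpenQuotientMap_toTorus : IsOpenQuotientMap (toTorus (d := d) (n := n)) := by
  have h1 : IsOpenQuotientMap (Pi.map fun (_ : Fin n × Fin d) (x : ℝ) => (x : UnitAddCircle)) :=
    IsOpenQuotientMap.piMap fun _ => QuotientAddGroup.isOpenQuotientMap_mk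
  let e : Dom d n ≃ₜ (Fin n × Fin d → ℝ) :=
    { toFun := fun y p => y p.1 p.2
      invFun := fun x i k => x (i, k)
      left_inv := fun _ => rfl
      right_inv := fun _ => rfl
      continuous_toFun := by fun_prop
      continuous_invFun := by fun_prop }
  exact h1.comp e.isOpenQuotientMap

/-- The normalized Haar measure of the torus. -/
def torusMeasure (d n : ℕ) : Measure (UnitAddTorus (Fin n × Fin d)) :=
  Measure.pi fun _ => AddCircle.haarAddCircle

instance : IsProbabilityMeasure (torusMeasure d n) := by unfold torusMeasure; infer_instance

instance : (torusMeasure d n).IsAddHaarMeasure := by unfold torusMeasure; infer_instance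

/-- Continuous multiperiodic functions. -/
structure ContPer {E : Type*} [TopologicalSpace E] (u : Dom d n → E) : Prop where
  cont : Continuous u
  per : ∀ (y : Dom d n) (z : Fin n → Fin d → ℤ), u (fun i k => y i k + (z i k : ℝ)) = u y

/-- The mean value over the torus. -/
def avg {E : Type*} [NormedAddCommGroup E] [NormedSpace ℝ E] (u : Dom d n → E) : E :=
  ∫ t, u (repr t) ∂torusMeasure d n

namespace ContPer

variable {E : Type*} [NormedAddCommGroup E]

lemma apply_repr_toTorus {u : Dom d n → E} (hu : ContPer u) (y : Dom d n) :
    u (repr (toTorus y)) = u y := by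
  have h : ∀ p : Fin n × Fin d, ∃ z : ℤ, (z : ℝ) = repr (toTorus y) p.1 p.2 - y p.1 p.2 := by
    intro p
    have h1 : ((repr (toTorus y) p.1 p.2 : ℝ) : UnitAddCircle) = (y p.1 p.2 : UnitAddCircle) :=
      congrFun (toTorus_repr (toTorus y)) p
    obtain ⟨z, hz⟩ := AddSubgroup.mem_zmultiples_iff.mp (QuotientAddGroup.eq.mp h1.symm)
    refine ⟨z, ?_⟩
    simp only [zsmul_eq_mul, mul_one] at hz
    rw [hz]; ring
  choose z hz using h
  rw [← hu.per y fun i k => z (i, k)]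
  congr 1
  funext i k
  rw [hz (i, k)]; ring

lemma continuous_repr {u : Dom d n → E} (hu : ContPer u) :
    Continuous fun t => u (repr t) := by
  rw [isOpenQuotientMap_toTorus.isQuotientMap.continuous_iff]
  exact hu.cont.congr fun y => (hu.apply_repr_toTorus y).symm

lemma integrable {u : Dom d n → E} (hu : ContPer u) :
    Integrable (fun t => u (repr t)) (torusMeasure d n) :=
  hu.continuous_repr.integrable_of_hasCompactSupport (HasCompactSupport.of_compactSpace _)

lemma exists_bound {u : Dom d n → E} (hu : ContPer u) : ∃ C, ∀ y, ‖u y‖ ≤ C := by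
  obtain ⟨C, hC⟩ := (isCompact_range hu.continuous_repr.norm).bddAbove
  refine ⟨C, fun y => ?_⟩
  rw [← hu.apply_repr_toTorus y]
  exact hC ⟨toTorus y, rfl⟩

lemma sum {κ : Type*} {s : Finset κ} {u : κ → Dom d n → E} (hu : ∀ i ∈ s, ContPer (u i)) :
    ContPer fun y => ∑ i ∈ s, u i y :=
  ⟨continuous_finsetSum _ fun i hi => (hu i hi).cont,
    fun y z => Finset.sum_congr rfl fun i hi => (hu i hi).per y z⟩

lemma mul {R : Type*} [NormedRing R] {u v : Dom d n → R} (hu : ContPer u) (hv : ContPer v) :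
    ContPer fun y => u y * v y :=
  ⟨hu.cont.mul hv.cont, fun y z => by rw [hu.per, hv.per]⟩

lemma const (c : E) : ContPer fun _ : Dom d n => c := ⟨continuous_const, fun _ _ => rfl⟩

lemma chr (m : Freq d n) : ContPer (chr m) := ⟨(contDiff_chr m).continuous, chr_translate m⟩

lemma ofReal {u : Dom d n → ℝ} (hu : ContPer u) : ContPer fun y => (u y : ℂ) :=
  ⟨Complex.continuous_ofReal.comp hu.cont, fun y z => by rw [hu.per]⟩

lemma fderiv_apply [NormedSpace ℝ E] {u : Dom d n → E} (hu : ContPer u) (hs : ContDiff ℝ 1 u)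
    (v : Dom d n) : ContPer fun y => fderiv ℝ u y v := by
  refine ⟨(hs.continuous_fderiv (by simp)).clm_apply continuous_const, fun y z => ?_⟩
  have h : u = fun y => u (y + fun i k => (z i k : ℝ)) := funext fun y => (hu.per y z).symm
  have h2 : fderiv ℝ u y = fderiv ℝ u (y + fun i k => (z i k : ℝ)) := by
    conv_lhs => rw [h]
    rw [fderiv_comp_add_right]
  rw [h2]
  rfl

end ContPer

section Avg

variable {E : Type*} [NormedAddCommGroup E] [NormedSpace ℝ E]

lemma avg_sum {κ : Type*} {s : Finset κ} {u : κ → Dom d n → E} (hu : ∀ i ∈ s, ContPer (u i)) :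
    avg (fun y => ∑ i ∈ s, u i y) = ∑ i ∈ s, avg (u i) :=
  integral_finsetSum s fun i hi => (hu i hi).integrable

lemma avg_const_mul (c : ℂ) (u : Dom d n → ℂ) : avg (fun y => c * u y) = c * avg u :=
  integral_const_mul c _

lemma norm_avg_le {u : Dom d n → E} {C : ℝ} (h : ∀ y, ‖u y‖ ≤ C) : ‖avg u‖ ≤ C := by
  have h1 := norm_integral_le_of_norm_le_const (μ := torusMeasure d n)
    (Eventually.of_forall fun t => h (repr t))
  rwa [probReal_univ, mul_one] at h1

/-- The mean of a derivative of a multiperiodic function vanishes. -/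
lemma avg_fderiv [CompleteSpace E] {u : Dom d n → E} (hu : ContPer u) (hs : ContDiff ℝ 1 u)
    (v : Dom d n) : avg (fun y => fderiv ℝ u y v) = 0 := by
  have hD := hu.fderiv_apply hs v
  obtain ⟨C, hC⟩ := hD.exists_bound
  have hcurve : ∀ t : UnitAddTorus (Fin n × Fin d), ∀ h : ℝ,
      t + toTorus (h • v) = toTorus (repr t + h • v) := by
    intro t h
    rw [toTorus_add, toTorus_repr]
  have h := hasDerivAt_integral_of_dominated_loc_of_deriv_le (μ := torusMeasure d n)
    (s := Set.univ) (x₀ := (0 : ℝ)) (bound := fun _ => C)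
    (F := fun h t => u (repr (t + toTorus (h • v))))
    (F' := fun h t => fderiv ℝ u (repr (t + toTorus (h • v))) v) Filter.univ_mem
    (Eventually.of_forall fun h =>
      (hu.continuous_repr.comp (continuous_add_const _)).aestronglyMeasurable)
    ((hu.continuous_repr.comp (continuous_add_const _)).integrable_of_hasCompactSupport
      (HasCompactSupport.of_compactSpace _))
    (hD.continuous_repr.comp (continuous_add_const _)).aestronglyMeasurable
    (Eventually.of_forall fun t h _ => hC _)
    (integrable_const C)
    (Eventually.of_forall fun t h _ => by
      simp only [hcurve, hu.apply_repr_toTorus, hD.apply_repr_toTorus]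
      have h1 : HasDerivAt (fun h : ℝ => repr t + h • v) v h := by
        simpa using ((hasDerivAt_id h).smul_const v).const_add (repr t)
      exact ((hs.differentiable (by simp) _).hasFDerivAt).comp_hasDerivAt h h1)
  have hconst : (fun h : ℝ => ∫ t, u (repr (t + toTorus (h • v))) ∂torusMeasure d n)
      = fun _ => avg u := by
    funext h
    exact integral_add_right_eq_self (fun t => u (repr t)) _
  have h2 := h.2
  rw [hconst] at h2
  have h3 := h2.unique (hasDerivAt_const (0 : ℝ) (avg u))
  have h0 : toTorus ((0 : ℝ) • v) = 0 := by
    funext p; simp [toTorus]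
  simp only [h0, add_zero] at h3
  exact h3

lemma avg_sq_eq_zero {u : Dom d n → ℝ} (hu : ContPer u) (h : avg (fun y => u y ^ 2) = 0) :
    u = 0 := by
  have hc : Continuous fun t => u (repr t) ^ 2 := hu.continuous_repr.pow 2
  have h1 := (integral_eq_zero_iff_of_nonneg (μ := torusMeasure d n)
    (fun t => sq_nonneg (u (repr t)))
    (hc.integrable_of_hasCompactSupport (HasCompactSupport.of_compactSpace _))).mp h
  have h2 := (hc.ae_eq_iff_eq (torusMeasure d n) continuous_const).mp h1
  funext y
  have h3 : u (repr (toTorus y)) ^ 2 = 0 := congrFun h2 (toTorus y)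
  rw [hu.apply_repr_toTorus] at h3
  exact pow_eq_zero_iff two_ne_zero |>.mp h3

end Avg

end Torus

/-! ### Fourier coefficients of multiperiodic functions -/

section Fourier

open scoped ContDiff ComplexConjugate

variable {d n : ℕ}

/-- The unit vector in the coordinate direction `p`. -/
def unitVec (p : Fin n × Fin d) : Dom d n := Pi.single p.1 (Pi.single p.2 1)

lemma unitVec_apply (p : Fin n × Fin d) (i : Fin n) (k : Fin d) :
    unitVec p i k = if (i, k) = p then 1 else 0 := by
  obtain ⟨j, l⟩ := p
  rcases eq_or_ne i j with rfl | h
  · rcases eq_or_ne k l with rfl | h'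
    · simp [unitVec]
    · simp [unitVec, h']
  · simp [unitVec, h]

lemma phase_unitVec (m : Freq d n) (p : Fin n × Fin d) : phase m (unitVec p) = 2 * π * m p := by
  simp [phase_apply, unitVec_apply]

lemma norm_unitVec_le (p : Fin n × Fin d) : ‖unitVec p‖ ≤ 1 := by
  refine (pi_norm_le_iff_of_nonneg zero_le_one).mpr fun i =>
    (pi_norm_le_iff_of_nonneg zero_le_one).mpr fun k => ?_
  rw [unitVec_apply]
  split_ifs <;> simp

/-- Fourier coefficients of a real multiperiodic function. -/
def coeff (u : Dom d n → ℝ) (m : Freq d n) : ℂ := avg fun y => chr (-m) y * (u y : ℂ)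

lemma conj_chr (m : Freq d n) (y : Dom d n) : conj (chr m y) = chr (-m) y := by
  have h : phase (-m) y = -phase m y := by
    simp [phase_apply]
  rw [chr, chr, ← Complex.exp_conj, h]
  simp

lemma coeff_fderiv {u : Dom d n → ℝ} (hu : ContPer u) (hs : ContDiff ℝ 1 u) (v : Dom d n)
    (m : Freq d n) : coeff (fun y => fderiv ℝ u y v) m = Complex.I * phase m v * coeff u m := by
  have hsu : ContDiff ℝ 1 fun y => (u y : ℂ) := Complex.ofRealCLM.contDiff.comp hs
  have hsc : ContDiff ℝ 1 (chr (-m)) := (contDiff_chr (-m)).of_le (by exact_mod_cast le_top)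
  have hprod := avg_fderiv ((ContPer.chr (-m)).mul hu.ofReal) (hsc.mul hsu) v
  have hpt : ∀ y, fderiv ℝ (fun y => chr (-m) y * (u y : ℂ)) y v
      = chr (-m) y * ((fderiv ℝ u y v : ℝ) : ℂ)
        + -(Complex.I * phase m v) * (chr (-m) y * (u y : ℂ)) := by
    intro y
    have hu' : HasFDerivAt (fun y => (u y : ℂ)) (Complex.ofRealCLM.comp (fderiv ℝ u y)) y :=
      Complex.ofRealCLM.hasFDerivAt.comp y (hs.differentiable (by simp) y).hasFDerivAt
    have hm : HasFDerivAt (fun y => chr (-m) y * (u y : ℂ)) _ y :=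
      (hasFDerivAt_chr (-m) y).mul hu'
    rw [hm.fderiv]
    have h : phase (-m) v = -phase m v := by simp [phase_apply]
    simp [h]
    ring
  simp only [hpt] at hprod
  have h1 : ContPer fun y => chr (-m) y * ((fderiv ℝ u y v : ℝ) : ℂ) :=
    (ContPer.chr (-m)).mul (hu.fderiv_apply hs v).ofReal
  have h2 : ContPer fun y => -(Complex.I * phase m v) * (chr (-m) y * (u y : ℂ)) :=
    (ContPer.const _).mul ((ContPer.chr (-m)).mul hu.ofReal)
  rw [avg, integral_add h1.integrable h2.integrable] at hprod
  have h4 : coeff (fun y => fderiv ℝ u y v) m + -(Complex.I * phase m v) * coeff u m = 0 := by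
    rw [coeff, coeff, ← avg_const_mul]
    exact hprod
  linear_combination h4

lemma coeff_one (m : Freq d n) : coeff (fun _ => 1) m = if m = 0 then 1 else 0 := by
  split_ifs with h
  · subst h
    have h1 : ∀ y : Dom d n, chr (-0) y * ((1 : ℝ) : ℂ) = 1 := fun y => by
      simp [chr, phase_apply]
    simp only [coeff, h1, avg]
    simp
  · obtain ⟨p, hp⟩ := Function.ne_iff.mp h
    have h1 := coeff_fderiv (ContPer.const (1 : ℝ)) contDiff_const (unitVec p) m
    have h2 : coeff (fun y : Dom d n => fderiv ℝ (fun _ : Dom d n => (1 : ℝ)) y (unitVec p)) m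
        = 0 := by
      simp [coeff, avg]
    rw [h2, phase_unitVec] at h1
    have h3 : Complex.I * ((2 * π * m p : ℝ) : ℂ) ≠ 0 := by
      refine mul_ne_zero Complex.I_ne_zero (Complex.ofReal_ne_zero.mpr ?_)
      have : (m p : ℝ) ≠ 0 := by exact_mod_cast hp
      positivity
    exact (mul_eq_zero.mp h1.symm).resolve_left h3

lemma norm_coeff_le {u : Dom d n → ℝ} {M : ℝ} (h : ∀ y, |u y| ≤ M) (m : Freq d n) :
    ‖coeff u m‖ ≤ M := by
  refine norm_avg_le fun y => ?_
  rw [norm_mul, norm_chr, one_mul, Complex.norm_real]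
  exact h y

lemma abs_pow_mul_norm_coeff_le {u : Dom d n → ℝ} (hs : ContDiff ℝ ∞ u) (hper : MPeriodic u)
    (p : Fin n × Fin d) (l : ℕ) {M : ℝ}
    (h : ∀ y, |iteratedFDeriv ℝ l u y fun _ => unitVec p| ≤ M) (m : Freq d n) :
    |2 * π * m p| ^ l * ‖coeff u m‖ ≤ M := by
  have hcont : ∀ l, ContDiff ℝ 1 fun y => iteratedFDeriv ℝ l u y fun _ => unitVec p := fun l =>
    (ContinuousMultilinearMap.apply ℝ (fun _ : Fin l => Dom d n) ℝ
      (fun _ => unitVec p)).contDiff.comp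
        (hs.iteratedFDeriv_right (m := 1) (by exact_mod_cast le_top))
  have hP : ∀ l, ContPer fun y => iteratedFDeriv ℝ l u y fun _ => unitVec p := fun l =>
    ⟨(hcont l).continuous, fun y z => by
      have h1 : u = fun y => u (y + fun i k => (z i k : ℝ)) :=
        funext fun y => (hper y z).symm
      have h2 : iteratedFDeriv ℝ l u y = iteratedFDeriv ℝ l u (y + fun i k => (z i k : ℝ)) := by
        conv_lhs => rw [h1]
        rw [iteratedFDeriv_comp_add_right]
      rw [h2]; rfl⟩
  have hrec : ∀ l, coeff (fun y => iteratedFDeriv ℝ l u y fun _ => unitVec p) m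
      = (Complex.I * phase m (unitVec p)) ^ l * coeff u m := by
    intro l
    induction l with
    | zero => simp
    | succ l ih =>
      rw [pow_succ', mul_assoc, ← ih, ← coeff_fderiv (hP l) (hcont l)]
      congr 1
      funext y
      rw [iteratedFDeriv_succ_apply_left]
      have hd : DifferentiableAt ℝ (iteratedFDeriv ℝ l u) y :=
        (hs.differentiable_iteratedFDeriv (by exact_mod_cast WithTop.coe_lt_top l)) y
      have h3 := ((ContinuousMultilinearMap.apply ℝ (fun _ : Fin l => Dom d n) ℝ
        (fun _ => unitVec p)).hasFDerivAt.comp y hd.hasFDerivAt).fderiv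
      exact (congrArg (fun L => L (unitVec p)) h3).symm
  have h4 := norm_coeff_le h m
  rw [hrec, norm_mul, norm_pow, norm_mul, Complex.norm_I, one_mul, phase_unitVec,
    Complex.norm_real, Real.norm_eq_abs] at h4
  exact h4

lemma coeff_expDecay {u : Dom d n → ℝ} (hs : ContDiff ℝ ∞ u) (hper : MPeriodic u) {C₀ Λ₀ : ℝ}
    (hC : 0 ≤ C₀) (hΛ : 0 < Λ₀) (hd : 0 < d) (hn : 0 < n)
    (h : ∀ (l : ℕ) (p : Fin n × Fin d) (y : Dom d n),
      |iteratedFDeriv ℝ l u y fun _ => unitVec p| ≤ C₀ * Λ₀ ^ l * l.factorial) :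
    ExpDecay (2 * C₀) (π / (Λ₀ * (n * d))) (coeff u) := by
  intro m
  have hone : ∀ p, ‖coeff u m‖ ≤ 2 * C₀ * Real.exp (-(|2 * π * m p| / (2 * Λ₀))) := by
    intro p
    set t := |2 * π * m p| with ht
    have ht0 : 0 ≤ t := abs_nonneg _
    have h1 : HasSum (fun l : ℕ => (t / (2 * Λ₀)) ^ l / l.factorial * ‖coeff u m‖)
        (Real.exp (t / (2 * Λ₀)) * ‖coeff u m‖) := by
      rw [Real.exp_eq_exp_ℝ]
      exact (NormedSpace.expSeries_div_hasSum_exp (t / (2 * Λ₀))).mul_right _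
    have h2 : HasSum (fun l : ℕ => C₀ * (1 / 2 : ℝ) ^ l) (C₀ * 2) :=
      hasSum_geometric_two.mul_left C₀
    have h3 := hasSum_le (fun l : ℕ => ?_) h1 h2
    · rw [Real.exp_neg, ← div_eq_mul_inv, le_div_iff₀ (Real.exp_pos _)]
      linarith
    · have h4 := abs_pow_mul_norm_coeff_le hs hper p l (h l p) m
      rw [← ht] at h4
      calc (t / (2 * Λ₀)) ^ l / l.factorial * ‖coeff u m‖
          = (t ^ l * ‖coeff u m‖) / ((2 * Λ₀) ^ l * l.factorial) := by rw [div_pow]; field_simp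
        _ ≤ (C₀ * Λ₀ ^ l * l.factorial) / ((2 * Λ₀) ^ l * l.factorial) := by gcongr
        _ = C₀ * (1 / 2 : ℝ) ^ l := by
          rw [mul_pow, div_pow, one_pow]; field_simp
  obtain ⟨p, -, hp⟩ : ∃ p ∈ (Finset.univ : Finset (Fin n × Fin d)),
      latNorm m / (n * d) ≤ |(m p : ℝ)| := by
    refine Finset.exists_le_of_sum_le ⟨(⟨0, hn⟩, ⟨0, hd⟩), Finset.mem_univ _⟩ ?_
    rw [Finset.sum_const, Finset.card_univ, Fintype.card_prod, Fintype.card_fin,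
      Fintype.card_fin, nsmul_eq_mul, latNorm]
    have h1 : (0 : ℝ) < n := by exact_mod_cast hn
    have h2 : (0 : ℝ) < d := by exact_mod_cast hd
    push_cast
    rw [mul_div_cancel₀ _ (by positivity)]
  refine (hone p).trans ?_
  gcongr
  rw [abs_mul, abs_of_pos (by positivity : 0 < 2 * π)]
  have h1 : (0 : ℝ) < n := by exact_mod_cast hn
  have h2 : (0 : ℝ) < d := by exact_mod_cast hd
  calc π / (Λ₀ * (n * d)) * latNorm m = π / Λ₀ * (latNorm m / (n * d)) := by field_simp
    _ ≤ π / Λ₀ * |(m p : ℝ)| := by gcongr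
    _ = _ := by field_simp

lemma trig_coeff {u : Dom d n → ℝ} (hu : ContPer u) {K a : ℝ} (hdec : ExpDecay K a (coeff u))
    (ha : 0 < a) (y : Dom d n) : trig (coeff u) y = u y := by
  let f : C(UnitAddTorus (Fin n × Fin d), ℂ) :=
    ⟨fun t => (u (repr t) : ℂ), hu.ofReal.continuous_repr⟩
  have hchr : ∀ (m : Freq d n) (z : Dom d n), UnitAddTorus.mFourier m (toTorus z) = chr m z := by
    intro m z
    simp only [UnitAddTorus.mFourier, ContinuousMap.coe_mk, toTorus, fourier_coe_apply, chr]
    rw [← Complex.exp_sum]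
    congr 1
    rw [phase_apply]
    push_cast
    rw [Finset.sum_mul]
    refine Finset.sum_congr rfl fun p _ => ?_
    simp
    ring
  have hco : UnitAddTorus.mFourierCoeff (f : UnitAddTorus (Fin n × Fin d) → ℂ) = coeff u := by
    funext m
    have h : ∀ t, UnitAddTorus.mFourier (-m) t • f t = chr (-m) (repr t) * (u (repr t) : ℂ) := by
      intro t
      conv_lhs => rw [← toTorus_repr t]
      rw [hchr, toTorus_repr]
      rfl
    rw [UnitAddTorus.mFourierCoeff]
    simp only [h]
    rfl
  have hs := UnitAddTorus.hasSum_mFourier_series_apply_of_summable (f := f)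
    (by rw [hco]; exact Summable.of_norm (hdec.summable_norm ha)) (toTorus y)
  rw [hco] at hs
  simp only [hchr] at hs
  have h2 : f (toTorus y) = u y := congrArg (fun r : ℝ => (r : ℂ)) (hu.apply_repr_toTorus y)
  rw [h2] at hs
  exact hs.tsum_eq

end Fourier

/-! ### Coercivity of the Fourier symbol -/

section Coercive

open scoped ComplexConjugate

variable {d n : ℕ}

lemma sum_coeff_eq_avg {u : Dom d n → ℝ} (hu : ContPer u) (F : Finset (Freq d n))
    (g h : Freq d n → ℂ) :
    ∑ m ∈ F, ∑ j ∈ F, conj (g m) * (coeff u (m - j) * h j)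
      = avg fun y => conj (∑ m ∈ F, g m * chr m y) * (u y : ℂ) * ∑ j ∈ F, h j * chr j y := by
  have hterm : ∀ m j, ContPer fun y : Dom d n =>
      conj (g m) * h j * (chr (-(m - j)) y * (u y : ℂ)) := fun m j =>
    (ContPer.const _).mul ((ContPer.chr _).mul hu.ofReal)
  have hpt : (fun y => conj (∑ m ∈ F, g m * chr m y) * (u y : ℂ) * ∑ j ∈ F, h j * chr j y)
      = fun y => ∑ m ∈ F, ∑ j ∈ F, conj (g m) * h j * (chr (-(m - j)) y * (u y : ℂ)) := by
    funext y
    rw [map_sum, Finset.sum_mul, Finset.sum_mul]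
    refine Finset.sum_congr rfl fun m _ => ?_
    rw [Finset.mul_sum]
    refine Finset.sum_congr rfl fun j _ => ?_
    rw [neg_sub, sub_eq_add_neg, chr_add, map_mul, conj_chr]
    ring
  rw [hpt, avg_sum fun m _ => ContPer.sum fun j _ => hterm m j]
  refine Finset.sum_congr rfl fun m _ => ?_
  rw [avg_sum fun j _ => hterm m j]
  refine Finset.sum_congr rfl fun j _ => ?_
  rw [avg_const_mul, coeff]
  ring

lemma avg_re_mono {V W : Dom d n → ℂ} (hV : ContPer V) (hW : ContPer W)
    (h : ∀ y, (V y).re ≤ (W y).re) : (avg V).re ≤ (avg W).re := by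
  have hre : ∀ {U : Dom d n → ℂ}, ContPer U →
      (avg U).re = ∫ t, (U (repr t)).re ∂torusMeasure d n := fun hU =>
    (integral_re hU.integrable).symm
  rw [hre hV, hre hW]
  exact integral_mono hV.integrable.re hW.integrable.re fun t => h _

lemma elliptic_complex {lam : ℝ} {B : Fin d → Fin d → ℝ}
    (hB : ∀ ξ : Fin d → ℝ, lam * ∑ k, ξ k ^ 2 ≤ ∑ k, ξ k * ∑ l, B k l * ξ l) (w : Fin d → ℂ) :
    lam * ∑ k, ‖w k‖ ^ 2 ≤ (∑ k, ∑ l, conj (w k) * (B k l : ℂ) * w l).re := by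
  have h1 := hB fun k => (w k).re
  have h2 := hB fun k => (w k).im
  calc lam * ∑ k, ‖w k‖ ^ 2
      = lam * ∑ k, (w k).re ^ 2 + lam * ∑ k, (w k).im ^ 2 := by
        rw [← mul_add, ← Finset.sum_add_distrib]
        congr 1
        refine Finset.sum_congr rfl fun k _ => ?_
        rw [Complex.sq_norm, Complex.normSq_apply]; ring
    _ ≤ _ := add_le_add h1 h2
    _ = _ := by
        rw [Complex.re_sum, ← Finset.sum_add_distrib]
        refine Finset.sum_congr rfl fun k _ => ?_
        rw [Complex.re_sum, Finset.mul_sum, Finset.mul_sum, ← Finset.sum_add_distrib]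
        refine Finset.sum_congr rfl fun l _ => ?_
        simp
        ring

/-- The Fourier symbol of an elliptic coefficient field is coercive on finite truncations. -/
lemma coercive_coeff {lam : ℝ} {A : Dom d n → Fin d → Fin d → ℝ}
    (hA : ∀ k l, ContPer fun y => A y k l)
    (hell : ∀ y (ξ : Fin d → ℝ), lam * ∑ k, ξ k ^ 2 ≤ ∑ k, ξ k * ∑ l, A y k l * ξ l)
    (F : Finset (Freq d n)) (f : Fin d → Freq d n → ℂ) :
    lam * ∑ k, ∑ m ∈ F, ‖f k m‖ ^ 2
      ≤ (∑ k, ∑ l, ∑ m ∈ F, ∑ j ∈ F,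
          conj (f k m) * (coeff (fun y => A y k l) (m - j) * f l j)).re := by
  classical
  have hG : ∀ k, ContPer fun y => ∑ m ∈ F, f k m * chr m y := fun k =>
    ContPer.sum fun m _ => (ContPer.const _).mul (ContPer.chr m)
  have hGc : ∀ k, ContPer fun y => conj (∑ m ∈ F, f k m * chr m y) := fun k =>
    ⟨Complex.continuous_conj.comp (hG k).cont, fun y z => congrArg _ ((hG k).per y z)⟩
  have hone : ContPer fun _ : Dom d n => (1 : ℝ) := ContPer.const 1
  have hterm : ∀ k l, ContPer fun y => conj (∑ m ∈ F, f k m * chr m y) * (A y k l : ℂ)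
      * ∑ j ∈ F, f l j * chr j y := fun k l => ((hGc k).mul (hA k l).ofReal).mul (hG l)
  have hterm1 : ∀ k, ContPer fun y => conj (∑ m ∈ F, f k m * chr m y) * ((1 : ℝ) : ℂ)
      * ∑ j ∈ F, f k j * chr j y := fun k => ((hGc k).mul hone.ofReal).mul (hG k)
  have hleft : ((lam * ∑ k, ∑ m ∈ F, ‖f k m‖ ^ 2 : ℝ) : ℂ)
      = avg fun y => (lam : ℂ) * ∑ k, conj (∑ m ∈ F, f k m * chr m y) * ((1 : ℝ) : ℂ)
          * ∑ j ∈ F, f k j * chr j y := by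
    rw [avg_const_mul, avg_sum fun k _ => hterm1 k]
    push_cast
    congr 1
    refine Finset.sum_congr rfl fun k _ => ?_
    have h := sum_coeff_eq_avg hone F (f k) (f k)
    simp only [Complex.ofReal_one] at h
    rw [← h]
    refine Finset.sum_congr rfl fun m hm => ?_
    simp only [coeff_one, sub_eq_zero]
    rw [Finset.sum_eq_single_of_mem m hm fun j _ hj => by simp [hj.symm]]
    simp [Complex.conj_mul']
  have hright : ∑ k, ∑ l, ∑ m ∈ F, ∑ j ∈ F,
      conj (f k m) * (coeff (fun y => A y k l) (m - j) * f l j)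
      = avg fun y => ∑ k, ∑ l, conj (∑ m ∈ F, f k m * chr m y) * (A y k l : ℂ)
          * ∑ j ∈ F, f l j * chr j y := by
    rw [avg_sum fun k _ => ContPer.sum fun l _ => hterm k l]
    refine Finset.sum_congr rfl fun k _ => ?_
    rw [avg_sum fun l _ => hterm k l]
    exact Finset.sum_congr rfl fun l _ => sum_coeff_eq_avg (hA k l) F _ _
  rw [hright, ← Complex.ofReal_re (lam * _), hleft]
  refine avg_re_mono ((ContPer.const _).mul (ContPer.sum fun k _ => hterm1 k))
    (ContPer.sum fun k _ => ContPer.sum fun l _ => hterm k l) fun y => ?_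
  refine le_trans (le_of_eq ?_) (elliptic_complex (hell y) fun k => ∑ m ∈ F, f k m * chr m y)
  rw [← Complex.ofReal_re (lam * _)]
  congr 1
  push_cast
  congr 1
  refine Finset.sum_congr rfl fun k _ => ?_
  rw [mul_one, Complex.conj_mul']

/-- A weight exponent small enough to preserve coercivity. -/
lemma exists_weight (d n : ℕ) {K σ lam : ℝ} (hK : 0 ≤ K) (hσ : 0 < σ) (hlam : 0 < lam) :
    ∃ s, 0 < s ∧ s < σ ∧ d * ∑' m : Freq d n,
      K * (Real.exp (-(σ * latNorm m)) * (Real.exp (s * latNorm m) - 1)) ≤ lam / 2 := by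
  set Z := expMass d n (σ / 2) with hZ
  have hZ1 : 1 ≤ Z := one_le_expMass (half_pos hσ)
  set θ : ℝ := min 1 (lam / (2 * (d * K * Z + 1))) with hθ
  have hθ0 : 0 < θ := by positivity
  have hθ1 : θ ≤ 1 := min_le_left _ _
  have hexp : ∀ t : ℝ, 0 ≤ t → Real.exp (θ * t) - 1 ≤ θ * Real.exp t := by
    intro t ht
    have h := convexOn_exp.2 (Set.mem_univ t) (Set.mem_univ 0) hθ0.le (sub_nonneg.mpr hθ1)
      (by ring)
    simp only [smul_eq_mul, mul_zero, add_zero, Real.exp_zero, mul_one] at h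
    linarith
  refine ⟨θ * (σ / 2), by positivity, by nlinarith, ?_⟩
  have hb : ∀ m : Freq d n,
      K * (Real.exp (-(σ * latNorm m)) * (Real.exp (θ * (σ / 2) * latNorm m) - 1))
        ≤ K * θ * Real.exp (-(σ / 2 * latNorm m)) := by
    intro m
    have ht : 0 ≤ σ / 2 * latNorm m := mul_nonneg (half_pos hσ).le (latNorm_nonneg m)
    have h1 := hexp _ ht
    have h2 : Real.exp (-(σ * latNorm m)) * Real.exp (σ / 2 * latNorm m)
        = Real.exp (-(σ / 2 * latNorm m)) := by
      rw [← Real.exp_add]; ring_nf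
    rw [mul_assoc θ, mul_assoc K, ← h2]
    refine mul_le_mul_of_nonneg_left ?_ hK
    calc _ ≤ Real.exp (-(σ * latNorm m)) * (θ * Real.exp (σ / 2 * latNorm m)) := by gcongr
      _ = _ := by ring
  have hnn : ∀ m : Freq d n,
      0 ≤ K * (Real.exp (-(σ * latNorm m)) * (Real.exp (θ * (σ / 2) * latNorm m) - 1)) := by
    intro m
    refine mul_nonneg hK (mul_nonneg (Real.exp_pos _).le (sub_nonneg.mpr ?_))
    exact Real.one_le_exp (mul_nonneg (by positivity) (latNorm_nonneg m))
  have hsum := (summable_exp_latNorm (ι := Fin n × Fin d) (half_pos hσ)).mul_left (K * θ)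
  have htot := (Summable.of_nonneg_of_le hnn hb hsum).tsum_le_tsum hb hsum
  rw [tsum_mul_left (a := K * θ)] at htot
  change _ ≤ K * θ * Z at htot
  have hden : 0 < 2 * (d * K * Z + 1) := by positivity
  have hθ2 : θ * (2 * (d * K * Z + 1)) ≤ lam := by
    rw [← le_div_iff₀ hden]; exact min_le_right _ _
  calc _ ≤ (d : ℝ) * (K * θ * Z) := by gcongr
    _ ≤ lam / 2 := by nlinarith

end Coercive

/-! ### Construction of the corrector -/

section Existence

open scoped ContDiff

variable {d n : ℕ}

namespace ExpDecay

lemma sum {κ : Type*} {K a : ℝ} {s : Finset κ} {c : κ → Freq d n → ℂ}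
    (hc : ∀ i ∈ s, ExpDecay K a (c i)) : ExpDecay (s.card * K) a fun m => ∑ i ∈ s, c i m := by
  intro m
  refine (norm_sum_le_of_le s fun i hi => hc i hi m).trans (le_of_eq ?_)
  rw [Finset.sum_const, nsmul_eq_mul, mul_assoc]

lemma const_mul {K a : ℝ} {c : Freq d n → ℂ} (hc : ExpDecay K a c) {z : ℂ} (hz : ‖z‖ ≤ 1) :
    ExpDecay K a fun m => z * c m := by
  intro m
  rw [norm_mul]
  exact (mul_le_of_le_one_left (norm_nonneg _) hz).trans (hc m)

lemma phase_mul {K a : ℝ} {c : Freq d n → ℂ} (hc : ExpDecay K a c) (ha : 0 < a)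
    (v : Dom d n) :
    ExpDecay (‖v‖ * (4 * π / a) * K) (a / 2) fun m => Complex.I * phase m v * c m := by
  intro m
  have h1 := pow_mul_exp_le ha (latNorm_nonneg m) 1
  simp only [pow_one, Nat.factorial_one, Nat.cast_one, mul_one] at h1
  have h2 : |phase m v| ≤ 2 * π * latNorm m * ‖v‖ :=
    ((phase m).le_opNorm v).trans (by gcongr; exact norm_phase_le m)
  rw [norm_mul, norm_mul, Complex.norm_I, one_mul, Complex.norm_real, Real.norm_eq_abs]
  have hK := hc.const_nonneg
  calc |phase m v| * ‖c m‖
      ≤ (2 * π * latNorm m * ‖v‖) * (K * Real.exp (-(a * latNorm m))) :=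
        mul_le_mul h2 (hc m) (norm_nonneg _) ((abs_nonneg _).trans h2)
    _ = ‖v‖ * K * (2 * π * latNorm m * Real.exp (-(a * latNorm m))) := by ring
    _ ≤ ‖v‖ * K * (4 * π / a * Real.exp (-(a / 2 * latNorm m))) := by gcongr
    _ = _ := by ring

end ExpDecay

/-- Existence of a corrector given by a trigonometric series with exponentially decaying
coefficients. -/
theorem exists_corrector {A : Dom d n → Fin d → Fin d → ℝ} {K σ s lam τ : ℝ} (hs : 0 < s)
    (hsσ : s < σ) (hlam : 0 < lam) (hlam1 : lam ≤ 1) (hτ : 0 < τ) (hK : 0 ≤ K)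
    (hA : ∀ k l, ContPer fun y => A y k l)
    (hdec : ∀ k l, ExpDecay K σ (coeff fun y => A y k l))
    (hsmall : d * ∑' m : Freq d n,
      K * (Real.exp (-(σ * latNorm m)) * (Real.exp (s * latNorm m) - 1)) ≤ lam / 2)
    (hell : ∀ y (ξ : Fin d → ℝ), lam * ∑ k, ξ k ^ 2 ≤ ∑ k, ξ k * ∑ l, A y k l * ξ l)
    (w : Fin d → Dom d n) {v : Fin d → ℝ} (hv : ∀ l, |v l| ≤ 1)
    (hres : ∀ m : Freq d n, m ≠ 0 →
      (∃ l, 1 ≤ |phase m (w l)|) ∨ 1 ≤ τ * Real.exp (s / 2 * latNorm m)) {D : ℝ}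
    (hD : D = 2 * (d * (d * K) * expMass d n (σ - s)) / lam) :
    ∃ x : Freq d n → ℂ, ExpDecay D (s / 2) x ∧
      (∀ k, ExpDecay D s fun m => Complex.I * phase m (w k) * x m) ∧
      (ExpDecay D s fun m => (τ : ℂ) * x m) ∧
      ∀ y, -(∑ k, fderiv ℝ (fun y' => ∑ l, A y' k l
          * fderiv ℝ (fun z => (trig x z).re) y' (w l)) y (w k)) + τ ^ 2 * (trig x y).re
        = ∑ k, fderiv ℝ (fun y' => ∑ l, A y' k l * v l) y (w k) := by
  have hσ : 0 < σ := hs.trans hsσ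
  have hs2 : 0 < s / 2 := half_pos hs
  set b : Fin d → Freq d n → ℂ := fun k m => ∑ l, (v l : ℂ) * coeff (fun y => A y k l) m with hb
  have hbdec : ∀ k, ExpDecay (d * K) σ (b k) := by
    intro k
    have h := ExpDecay.sum (s := Finset.univ) (c := fun l m => (v l : ℂ) *
      coeff (fun y => A y k l) m) fun l _ => (hdec k l).const_mul (z := (v l : ℂ))
        (by rw [Complex.norm_real]; exact hv l)
    rwa [Finset.card_univ, Fintype.card_fin] at h
  obtain ⟨x, hx, hxP, hxτ⟩ := exists_convolution_solution hs hsσ hlam hlam1 hτ hK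
    (B := d * K) (by positivity) (a := fun k l => coeff fun y => A y k l) (b := b) hdec hbdec
    hsmall (coercive_coeff hA hell) fun k m => phase m (w k)
  change ∀ m k, _ ≤ 2 * (d * (d * K) * expMass d n (σ - s)) / lam * _ at hxP
  change ∀ m, _ ≤ 2 * (d * (d * K) * expMass d n (σ - s)) / lam * _ at hxτ
  rw [← hD] at hxP hxτ
  have hD0 : 0 ≤ D := nonneg_of_mul_nonneg_left ((by positivity : 0 ≤ τ * ‖x 0‖).trans (hxτ 0))
    (Real.exp_pos _)
  have hx0 : x 0 = 0 := by
    have h := hx 0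
    have h0 : ∀ k, phase (0 : Freq d n) (w k) = 0 := fun k => by simp [phase_apply]
    simp only [h0, Complex.ofReal_zero, zero_mul, mul_zero, Finset.sum_const_zero,
      add_zero] at h
    refine (mul_eq_zero.mp h).resolve_left ?_
    exact pow_ne_zero _ (Complex.ofReal_ne_zero.mpr hτ.ne')
  have hxdec : ExpDecay D (s / 2) x := by
    intro m
    rcases eq_or_ne m 0 with rfl | hm
    · rw [hx0, norm_zero]; positivity
    · rcases hres m hm with ⟨l, hl⟩ | h
      · have h1 := hxP m l
        rw [norm_mul, Complex.norm_real, Real.norm_eq_abs] at h1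
        refine ((le_mul_of_one_le_left (norm_nonneg _) hl).trans h1).trans ?_
        have := latNorm_nonneg m
        gcongr
        linarith
      · calc ‖x m‖ ≤ (τ * Real.exp (s / 2 * latNorm m)) * ‖x m‖ :=
              le_mul_of_one_le_left (norm_nonneg _) h
          _ = τ * ‖x m‖ * Real.exp (s / 2 * latNorm m) := by ring
          _ ≤ D * Real.exp (-(s * latNorm m)) * Real.exp (s / 2 * latNorm m) := by
              exact mul_le_mul_of_nonneg_right (hxτ m) (Real.exp_pos _).le
          _ = _ := by rw [mul_assoc, ← Real.exp_add]; ring_nf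
  have hgdec : ∀ k, ExpDecay D s fun m => Complex.I * phase m (w k) * x m := fun k m => by
    have h := hxP m k
    beta_reduce
    rwa [mul_assoc, norm_mul, Complex.norm_I, one_mul]
  refine ⟨x, hxdec, hgdec, fun m => ?_, fun y => ?_⟩
  · rw [norm_mul, Complex.norm_real, Real.norm_of_nonneg hτ.le]; exact hxτ m
  have hσs : 0 < σ - s := sub_pos.mpr hsσ
  have htrig_sum : ∀ {a C : ℝ} {c : Fin d → Freq d n → ℂ}, 0 < a → (∀ l, ExpDecay C a (c l)) →
      ∀ y, trig (fun m => ∑ l, c l m) y = ∑ l, trig (c l) y := by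
    intro a C c ha hc y
    simp only [trig, Finset.sum_mul]
    exact Summable.tsum_finsetSum fun l _ => (hc l).summable ha y
  set q : Fin d → Freq d n → ℂ := fun k m => ∑ l, latConv (coeff fun y => A y k l)
    (fun m => Complex.I * phase m (w l) * x m) m with hq
  have hconv : ∀ k l, ExpDecay (K * D * expMass d n (σ - s)) s (latConv (coeff fun y => A y k l)
      fun m => Complex.I * phase m (w l) * x m) := fun k l =>
    (hdec k l).latConv (hgdec l) hs.le hsσ
  have hqdec : ∀ k, ExpDecay (d * (K * D * expMass d n (σ - s))) s (q k) := by
    intro k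
    have h := ExpDecay.sum (s := Finset.univ) fun l _ => hconv k l
    rwa [Finset.card_univ, Fintype.card_fin] at h
  have hflux : ∀ k, (fun y' => ∑ l, A y' k l * fderiv ℝ (fun z => (trig x z).re) y' (w l))
      = fun y' => (trig (q k) y').re := by
    intro k
    funext y'
    rw [htrig_sum hs (hconv k), Complex.re_sum]
    refine Finset.sum_congr rfl fun l _ => ?_
    rw [hxdec.fderiv_trig_re hs2, ← trig_mul (hdec k l) hσ (hgdec l) hs,
      trig_coeff (hA k l) (hdec k l) hσ, Complex.re_ofReal_mul]
  have hrhs : ∀ k, (fun y' => ∑ l, A y' k l * v l) = fun y' => (trig (b k) y').re := by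
    intro k
    funext y'
    have hvdec : ∀ l, ExpDecay K σ fun m => (v l : ℂ) * coeff (fun y => A y k l) m := fun l =>
      (hdec k l).const_mul (by rw [Complex.norm_real]; exact hv l)
    rw [htrig_sum hσ hvdec, Complex.re_sum]
    refine Finset.sum_congr rfl fun l _ => ?_
    have h : trig (fun m => (v l : ℂ) * coeff (fun y => A y k l) m) y'
        = v l * trig (coeff fun y => A y k l) y' := by
      simp only [trig, mul_assoc]
      exact tsum_mul_left
    rw [h, trig_coeff (hA k l) (hdec k l) hσ, ← Complex.ofReal_mul, Complex.ofReal_re, mul_comm]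
  simp only [hflux, hrhs, fun k => (hqdec k).fderiv_trig_re hs y (w k),
    fun k => (hbdec k).fderiv_trig_re hσ y (w k)]
  have hS1 := hasSum_sum fun (k : Fin d) (_ : k ∈ Finset.univ) =>
    (((hqdec k).phase_mul hs (w k)).summable hs2 y).hasSum
  have hS2 := hasSum_sum fun (k : Fin d) (_ : k ∈ Finset.univ) =>
    (((hbdec k).phase_mul hσ (w k)).summable (half_pos hσ) y).hasSum
  have hS3 := ((hxdec.summable hs2 y).hasSum.mul_left ((τ : ℂ) ^ 2)).sub hS1
  have heq := (hS3.congr_fun fun m => ?_).unique hS2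
  · have h := congrArg Complex.re heq
    rw [Complex.sub_re, Complex.re_sum, Complex.re_sum, ← Complex.ofReal_pow,
      Complex.re_ofReal_mul] at h
    change τ ^ 2 * (trig x y).re - _ = _ at h
    rw [neg_add_eq_sub]
    exact h
  · rw [← Finset.sum_mul, ← Finset.sum_mul, ← hx m, ← mul_assoc, ← sub_mul]
    congr 1
    rw [sub_eq_add_neg, ← Finset.sum_neg_distrib]
    congr 1
    refine Finset.sum_congr rfl fun k _ => ?_
    have hql : ∀ l, latConv (coeff fun y => A y k l) (fun m => Complex.I * phase m (w l) * x m) m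
        = Complex.I * ∑' j, coeff (fun y => A y k l) (m - j) * ((phase j (w l) : ℂ) * x j) := by
      intro l
      rw [latConv, ← tsum_mul_left]
      exact tsum_congr fun j => by ring
    simp only [hq, hql, ← Finset.mul_sum]
    linear_combination ((phase m (w k) : ℂ) * ∑ l, ∑' j,
      coeff (fun y => A y k l) (m - j) * ((phase j (w l) : ℂ) * x j)) * Complex.I_mul_I

end Existence

/-! ### Uniqueness, small divisors and norm bounds -/

section Bounds

open scoped ContDiff

variable {d n : ℕ}

lemma contDiff_fderiv_apply {u : Dom d n → ℝ} (hu : ContDiff ℝ ∞ u) (w : Dom d n) :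
    ContDiff ℝ ∞ fun y => fderiv ℝ u y w :=
  (hu.fderiv_right (m := ∞) le_rfl).clm_apply contDiff_const

/-- Uniqueness of smooth multiperiodic solutions. -/
lemma corrector_unique {A : Dom d n → Fin d → Fin d → ℝ} {lam τ : ℝ} (hlam : 0 < lam)
    (hτ : 0 < τ) (hAs : ∀ k l, ContDiff ℝ ∞ fun y => A y k l)
    (hA : ∀ k l, ContPer fun y => A y k l)
    (hell : ∀ y (ξ : Fin d → ℝ), lam * ∑ k, ξ k ^ 2 ≤ ∑ k, ξ k * ∑ l, A y k l * ξ l)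
    (w : Fin d → Dom d n) {X X' : Dom d n → ℝ} (hXs : ContDiff ℝ ∞ X) (hX : MPeriodic X)
    (hXs' : ContDiff ℝ ∞ X') (hX' : MPeriodic X')
    (h : ∀ y, -(∑ k, fderiv ℝ (fun y' => ∑ l, A y' k l * fderiv ℝ X y' (w l)) y (w k))
        + τ ^ 2 * X y
      = -(∑ k, fderiv ℝ (fun y' => ∑ l, A y' k l * fderiv ℝ X' y' (w l)) y (w k))
        + τ ^ 2 * X' y) : X' = X := by
  have hle : (1 : WithTop ℕ∞) ≤ ∞ := by exact_mod_cast le_top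
  have hfl : ∀ {u : Dom d n → ℝ}, ContDiff ℝ ∞ u → ∀ k,
      ContDiff ℝ ∞ fun y => ∑ l, A y k l * fderiv ℝ u y (w l) := fun hu k =>
    ContDiff.sum fun l _ => (hAs k l).mul (contDiff_fderiv_apply hu (w l))
  set Z : Dom d n → ℝ := fun y => X' y - X y with hZ
  have hZs : ContDiff ℝ ∞ Z := hXs'.sub hXs
  have hZP : ContPer Z := ⟨hZs.continuous, fun y z => by simp only [hZ, hX y z, hX' y z]⟩
  have hdiff : ∀ {u : Dom d n → ℝ}, ContDiff ℝ ∞ u → Differentiable ℝ u := fun hu =>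
    hu.differentiable (by simp)
  have hZd : ∀ y l, fderiv ℝ Z y (w l) = fderiv ℝ X' y (w l) - fderiv ℝ X y (w l) := by
    intro y l
    have h1 : fderiv ℝ Z y = fderiv ℝ X' y - fderiv ℝ X y :=
      fderiv_sub (hdiff hXs' y) (hdiff hXs y)
    rw [h1]; rfl
  have hflZ : ∀ k, (fun y => ∑ l, A y k l * fderiv ℝ Z y (w l))
      = fun y => (∑ l, A y k l * fderiv ℝ X' y (w l)) - ∑ l, A y k l * fderiv ℝ X y (w l) := by
    intro k
    funext y
    simp only [hZd, mul_sub, Finset.sum_sub_distrib]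
  have hEq : ∀ y, ∑ k, fderiv ℝ (fun y' => ∑ l, A y' k l * fderiv ℝ Z y' (w l)) y (w k)
      = τ ^ 2 * Z y := by
    intro y
    have h1 : ∀ k, fderiv ℝ (fun y' => ∑ l, A y' k l * fderiv ℝ Z y' (w l)) y (w k)
        = fderiv ℝ (fun y' => ∑ l, A y' k l * fderiv ℝ X' y' (w l)) y (w k)
          - fderiv ℝ (fun y' => ∑ l, A y' k l * fderiv ℝ X y' (w l)) y (w k) := by
      intro k
      rw [hflZ, fderiv_fun_sub (hdiff (hfl hXs' k) y) (hdiff (hfl hXs k) y)]; rfl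
    simp only [h1, Finset.sum_sub_distrib]
    simp only [hZ]
    linarith [h y]
  have hZfP : ∀ k, ContPer fun y => ∑ l, A y k l * fderiv ℝ Z y (w l) := fun k =>
    ContPer.sum fun l _ => (hA k l).mul (hZP.fderiv_apply (hZs.of_le hle) (w l))
  have hmean : ∀ k, avg (fun y => fderiv ℝ
      (fun y' => Z y' * ∑ l, A y' k l * fderiv ℝ Z y' (w l)) y (w k)) = 0 := fun k =>
    avg_fderiv (hZP.mul (hZfP k)) ((hZs.mul (hfl hZs k)).of_le hle) (w k)
  have hterm : ∀ k, ContPer fun y => fderiv ℝ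
      (fun y' => Z y' * ∑ l, A y' k l * fderiv ℝ Z y' (w l)) y (w k) := fun k =>
    (hZP.mul (hZfP k)).fderiv_apply ((hZs.mul (hfl hZs k)).of_le hle) (w k)
  have hsum : avg (fun y => ∑ k, fderiv ℝ
      (fun y' => Z y' * ∑ l, A y' k l * fderiv ℝ Z y' (w l)) y (w k)) = 0 := by
    rw [avg_sum fun k _ => hterm k]
    exact Finset.sum_eq_zero fun k _ => hmean k
  have hlow : ∀ y, τ ^ 2 * Z y ^ 2 ≤ ∑ k, fderiv ℝ
      (fun y' => Z y' * ∑ l, A y' k l * fderiv ℝ Z y' (w l)) y (w k) := by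
    intro y
    have h1 : ∀ k, fderiv ℝ (fun y' => Z y' * ∑ l, A y' k l * fderiv ℝ Z y' (w l)) y (w k)
        = Z y * fderiv ℝ (fun y' => ∑ l, A y' k l * fderiv ℝ Z y' (w l)) y (w k)
          + fderiv ℝ Z y (w k) * ∑ l, A y k l * fderiv ℝ Z y (w l) := by
      intro k
      rw [fderiv_fun_mul (hdiff hZs y) (hdiff (hfl hZs k) y)]
      simp
      ring
    simp only [h1, Finset.sum_add_distrib, ← Finset.mul_sum, hEq]
    have h2 := hell y fun k => fderiv ℝ Z y (w k)
    have h3 : 0 ≤ lam * ∑ k, fderiv ℝ Z y (w k) ^ 2 :=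
      mul_nonneg hlam.le (Finset.sum_nonneg fun k _ => sq_nonneg _)
    nlinarith
  have hZ2 : ContPer fun y => Z y ^ 2 := by simpa only [pow_two] using hZP.mul hZP
  have hle0 : avg (fun y => τ ^ 2 * Z y ^ 2) ≤ 0 := by
    rw [← hsum]
    exact integral_mono ((ContPer.const (τ ^ 2)).mul hZ2).integrable
      (ContPer.sum fun k _ => hterm k).integrable fun t => hlow _
  have hmul : avg (fun y => τ ^ 2 * Z y ^ 2) = τ ^ 2 * avg (fun y => Z y ^ 2) :=
    integral_const_mul _ _
  have hnn : 0 ≤ avg (fun y => Z y ^ 2) := integral_nonneg fun t => sq_nonneg _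
  rw [hmul] at hle0
  have hzero : avg (fun y => Z y ^ 2) = 0 := by
    have : 0 < τ ^ 2 := by positivity
    nlinarith
  have hZ0 := avg_sq_eq_zero hZP hzero
  funext y
  exact sub_eq_zero.mp (congrFun hZ0 y)

/-- The direction `y ↦ ∑ δᵢ⁻¹ ∂/∂yᵢᵏ` underlying the directional gradient. -/
def hatVec (δ : Fin n → ℝ) (k : Fin d) : Dom d n := fun i => Pi.single k (δ i)⁻¹

lemma hatVec_eq_sum (δ : Fin n → ℝ) (k : Fin d) :
    hatVec δ k = ∑ i, (δ i)⁻¹ • (unitVec (i, k) : Dom d n) := by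
  funext i l
  simp [hatVec, Finset.sum_apply, unitVec_apply, Pi.single_apply, Finset.sum_ite_eq, ite_and]

lemma gradHatC_eq (δ : Fin n → ℝ) (k : Fin d) (u : Dom d n → ℝ) (y : Dom d n) :
    gradHatC δ n k u y = fderiv ℝ u y (hatVec δ k) := by
  rw [hatVec_eq_sum, map_sum]
  refine Finset.sum_congr rfl fun i _ => ?_
  rw [if_pos i.2, map_smul, smul_eq_mul]
  rfl

/-- Either the frequency is nonresonant in the direction of the directional gradient, or it is
so large that its amplitude is controlled by the massive term. -/
lemma phase_hatVec_dichotomy {δ : Fin n → ℝ} {c τ : ℝ} (hpos : ∀ i, 0 < δ i)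
    (hle : ∀ i, δ i ≤ 1) (hanti : ∀ i j, i ≤ j → δ j ≤ δ i) (hτ : 0 < τ) (hc : 0 < c)
    (hres : ∀ i j : Fin n, (i : ℕ) + 1 = j → Real.exp (-(c * (δ i / δ j))) ≤ τ ^ 2)
    (m : Freq d n) (hm : m ≠ 0) :
    (∃ k, 1 ≤ |phase m (hatVec δ k)|) ∨ 1 ≤ τ * Real.exp (c * latNorm m) := by
  classical
  obtain ⟨p, hp⟩ := Function.ne_iff.mp hm
  obtain ⟨⟨i, k⟩, hik, hmax⟩ := Finset.exists_max_image
    (Finset.univ.filter fun p : Fin n × Fin d => m p ≠ 0) Prod.fst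
    ⟨p, by simpa using hp⟩
  simp only [Finset.mem_filter, Finset.mem_univ, true_and] at hik hmax
  have hphase : phase m (hatVec δ k) = 2 * π * ∑ j, (m (j, k) : ℝ) * (δ j)⁻¹ := by
    rw [hatVec_eq_sum, map_sum, Finset.mul_sum]
    refine Finset.sum_congr rfl fun j _ => ?_
    rw [map_smul, phase_unitVec, smul_eq_mul]
    ring
  have hmain : (δ i)⁻¹ ≤ |(m (i, k) : ℝ) * (δ i)⁻¹| := by
    rw [abs_mul, abs_of_pos (inv_pos.mpr (hpos i))]
    refine le_mul_of_one_le_left (inv_pos.mpr (hpos i)).le ?_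
    have : (1 : ℤ) ≤ |m (i, k)| := Int.one_le_abs hik
    exact_mod_cast this
  have hsplit : ∑ j, (m (j, k) : ℝ) * (δ j)⁻¹
      = (m (i, k) : ℝ) * (δ i)⁻¹ + ∑ j ∈ Finset.univ.erase i, (m (j, k) : ℝ) * (δ j)⁻¹ :=
    (Finset.add_sum_erase _ _ (Finset.mem_univ i)).symm
  have hpi := Real.pi_gt_three
  have hδ1 : 1 ≤ (δ i)⁻¹ := (one_le_inv₀ (hpos i)).mpr (hle i)
  have hconcl : |∑ j ∈ Finset.univ.erase i, (m (j, k) : ℝ) * (δ j)⁻¹| ≤ (δ i)⁻¹ / 2 →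
      1 ≤ |phase m (hatVec δ k)| := by
    intro h
    rw [hphase, hsplit, abs_mul, abs_of_pos (by positivity : 0 < 2 * π)]
    have h1 := abs_sub_abs_le_abs_add ((m (i, k) : ℝ) * (δ i)⁻¹)
      (∑ j ∈ Finset.univ.erase i, (m (j, k) : ℝ) * (δ j)⁻¹)
    have h2 : 1 / 2 ≤ |(m (i, k) : ℝ) * (δ i)⁻¹
      + ∑ j ∈ Finset.univ.erase i, (m (j, k) : ℝ) * (δ j)⁻¹| := by linarith
    nlinarith
  rcases Nat.eq_zero_or_pos (i : ℕ) with hi | hi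
  · refine Or.inl ⟨k, hconcl ?_⟩
    rw [Finset.sum_eq_zero, abs_zero]
    · positivity
    · intro j hj
      have hmj : m (j, k) = 0 := by
        by_contra hne
        have h1 := hmax (j, k) hne
        have h2 : j ≠ i := Finset.ne_of_mem_erase hj
        exact h2 (le_antisymm h1 (Fin.le_def.mpr (by omega)))
      rw [hmj]; simp
  · let i' : Fin n := ⟨i - 1, by omega⟩
    have hi' : (i' : ℕ) + 1 = i := Nat.sub_add_cancel hi
    by_cases hsmall : latNorm m ≤ δ i' / δ i / 2
    · refine Or.inl ⟨k, hconcl ?_⟩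
      refine (Finset.abs_sum_le_sum_abs _ _).trans ?_
      have h1 : ∀ j ∈ Finset.univ.erase i,
          |(m (j, k) : ℝ) * (δ j)⁻¹| ≤ |(m (j, k) : ℝ)| * (δ i')⁻¹ := by
        intro j hj
        rw [abs_mul, abs_of_pos (inv_pos.mpr (hpos j))]
        by_cases hmj : m (j, k) = 0
        · simp [hmj]
        · have h1 : j ≤ i := hmax (j, k) hmj
          have h2 : j < i := lt_of_le_of_ne h1 (Finset.ne_of_mem_erase hj)
          have h3 : j ≤ i' := Fin.le_def.mpr (by have := Fin.lt_def.mp h2; omega)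
          have h4 := hanti j i' h3
          have := hpos i'
          gcongr
      refine (Finset.sum_le_sum h1).trans ?_
      rw [← Finset.sum_mul]
      have h2 : ∑ j ∈ Finset.univ.erase i, |(m (j, k) : ℝ)| ≤ latNorm m := by
        refine (Finset.sum_le_sum_of_subset_of_nonneg (Finset.subset_univ _)
          fun _ _ _ => abs_nonneg _).trans ?_
        rw [latNorm, Fintype.sum_prod_type]
        exact Finset.sum_le_sum fun j _ => Finset.single_le_sum
          (f := fun l => |(m (j, l) : ℝ)|) (fun _ _ => abs_nonneg _) (Finset.mem_univ k)
      have hδ' := hpos i'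
      calc _ ≤ (δ i' / δ i / 2) * (δ i')⁻¹ := by gcongr; exact h2.trans hsmall
        _ = (δ i)⁻¹ / 2 := by field_simp
    · refine Or.inr ?_
      have h1 := hres i' i hi'
      have h2 : Real.exp (-(c * latNorm m)) ^ 2 ≤ τ ^ 2 := by
        refine le_trans ?_ h1
        rw [← Real.exp_nat_mul]
        refine Real.exp_le_exp.mpr ?_
        push_cast
        nlinarith
      have h3 := (pow_le_pow_iff_left₀ (Real.exp_pos _).le hτ.le two_ne_zero).mp h2
      rwa [Real.exp_neg, inv_le_iff_one_le_mul₀ (Real.exp_pos _)] at h3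

lemma DAbs_le (l : ℕ) (u : Dom d n → ℝ) (y : Dom d n) :
    DAbs l u y ≤ ((n : ℝ) * d) ^ l * ‖iteratedFDeriv ℝ l u y‖ := by
  have h : ∀ idx : Fin l → Fin n × Fin d,
      |iteratedFDeriv ℝ l u y fun m => unitVec (idx m)| ≤ ‖iteratedFDeriv ℝ l u y‖ := by
    intro idx
    refine ((iteratedFDeriv ℝ l u y).le_opNorm _).trans ?_
    exact mul_le_of_le_one_right (norm_nonneg _)
      (Finset.prod_le_one (fun _ _ => norm_nonneg _) fun i _ => norm_unitVec_le _)
  refine (Finset.sum_le_sum fun idx _ => h idx).trans (le_of_eq ?_)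
  simp

lemma DAbs_nonneg (l : ℕ) (u : Dom d n → ℝ) (y : Dom d n) : 0 ≤ DAbs l u y :=
  Finset.sum_nonneg fun _ _ => abs_nonneg _

lemma abs_iteratedFDeriv_le_DAbs (l : ℕ) (u : Dom d n → ℝ) (y : Dom d n) (p : Fin n × Fin d) :
    |iteratedFDeriv ℝ l u y fun _ => unitVec p| ≤ DAbs l u y :=
  Finset.single_le_sum (f := fun idx : Fin l → Fin n × Fin d =>
    |iteratedFDeriv ℝ l u y fun m => unitVec (idx m)|) (fun _ _ => abs_nonneg _)
    (Finset.mem_univ fun _ => p)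

lemma DAbs_const_mul {u : Dom d n → ℝ} (hu : ContDiff ℝ ∞ u) {r : ℝ} (hr : 0 ≤ r) (l : ℕ)
    (y : Dom d n) : DAbs l (fun y => r * u y) y = r * DAbs l u y := by
  have h0 : (fun y => r * u y) = r • u := rfl
  have h : iteratedFDeriv ℝ l (fun y => r * u y) y = r • iteratedFDeriv ℝ l u y := h0 ▸
    iteratedFDeriv_const_smul_apply (hu.contDiffAt.of_le (by exact_mod_cast le_top))
  simp only [DAbs, h, Finset.mul_sum]
  refine Finset.sum_congr rfl fun idx _ => ?_
  simp [abs_mul, abs_of_nonneg hr]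

lemma DAbs_trig_re_le {c : Freq d n → ℂ} {K a : ℝ} (hc : ExpDecay K a c) (ha : 0 < a) (l : ℕ)
    (y : Dom d n) : DAbs l (fun y => (trig c y).re) y
      ≤ K * expMass d n (a / 2) * (n * d * (4 * π / a)) ^ l * l.factorial := by
  have h1 : ‖iteratedFDeriv ℝ l (fun y => (trig c y).re) y‖ ≤ ‖iteratedFDeriv ℝ l (trig c) y‖ := by
    have h := Complex.reCLM.norm_iteratedFDeriv_comp_left (n := l) (hc.contDiff_trig ha).contDiffAt
      (x := y) (by exact_mod_cast le_top)
    rw [Complex.reCLM_norm, one_mul] at h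
    exact h
  calc _ ≤ ((n : ℝ) * d) ^ l * ‖iteratedFDeriv ℝ l (fun y => (trig c y).re) y‖ := DAbs_le l _ y
    _ ≤ ((n : ℝ) * d) ^ l * (K * ((4 * π / a) ^ l * l.factorial * expMass d n (a / 2))) := by
        gcongr
        exact h1.trans (hc.norm_iteratedFDeriv_trig_le ha l y)
    _ = _ := by rw [mul_pow (↑n * ↑d : ℝ)]; ring

lemma volume_cell : volume (cell d n) = 1 := by
  have h : cell d n = Set.univ.pi fun _ : Fin n => Set.Icc (0 : Fin d → ℝ) 1 :=
    (Set.pi_univ_Icc _ _).symm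
  rw [h, volume_pi_pi]
  simp [Real.volume_Icc_pi]

lemma L2_le {F : Dom d n → ℝ} {M : ℝ} (hM : 0 ≤ M) (h : ∀ y, |F y| ≤ M) : L2 F ≤ M := by
  refine Real.sqrt_le_iff.mpr ⟨hM, ?_⟩
  have h1 := norm_setIntegral_le_of_norm_le_const (μ := volume) (s := cell d n)
    (f := fun y => F y ^ 2) (C := M ^ 2) (by rw [volume_cell]; exact ENNReal.one_lt_top)
    fun y _ => by
      rw [Real.norm_eq_abs, abs_pow]
      exact pow_le_pow_left₀ (abs_nonneg _) (h y) 2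
  rw [Measure.real, volume_cell, ENNReal.toReal_one, mul_one] at h1
  exact (le_abs_self _).trans h1

end Bounds
/-- Theorem 3.5: existence, uniqueness and uniform bounds for multiscale correctors
under the logarithmic scale-separation condition. -/
theorem statement4 (d n : ℕ) (hd : 1 ≤ d) (hn : 2 ≤ n) (lam C₀ Λ₀ : ℝ)
    (hlam : lam ∈ Set.Ioc (0 : ℝ) 1) (hC₀ : 1 ≤ C₀) (hΛ₀ : 0 < Λ₀) :
    ∃ (cj : ℕ → ℝ) (c C Cstar Λ : ℝ),
      (∀ j : ℕ, 2 ≤ j → j ≤ n → 0 < cj j) ∧ 0 < c ∧ 1 ≤ C ∧ 1 ≤ Cstar ∧ 1 ≤ Λ ∧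
      ∀ (A : Dom d n → Fin d → Fin d → ℝ),
        (∀ k l, ContDiff ℝ (⊤ : ℕ∞) fun y => A y k l) →
        (∀ k l, MPeriodic fun y => A y k l) →
        Elliptic lam A →
        (∀ (ℓ : ℕ) (y : Dom d n),
          (∑ k, ∑ l, DAbs ℓ (fun y' => A y' k l) y) ≤ C₀ * Λ₀ ^ ℓ * (Nat.factorial ℓ : ℝ)) →
      ∀ (ε : ℕ → ℝ), ε 1 ≤ 1 → (∀ j : ℕ, 1 ≤ j → j ≤ n → 0 < ε j) →
        (∀ j k : ℕ, 1 ≤ j → j < k → k ≤ n → ε k < ε j) →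
        (∀ j : ℕ, 2 ≤ j → j ≤ n →
          ε j ≤ cj j * ε (j - 1) / (1 + Real.log (ε 1 / ε (j - 1)))) →
      ∀ τ : ℝ, τ ∈ Set.Ioc (0 : ℝ) 1 →
        (∀ j : ℕ, 2 ≤ j → j ≤ n → Real.exp (-(c * ε (j - 1) / ε j)) ≤ τ ^ 2) →
      ∀ v : Fin d → ℝ, (∑ k, v k ^ 2) = 1 →
        ∃ X : Dom d n → ℝ,
          (ContDiff ℝ (⊤ : ℕ∞) X ∧ MPeriodic X ∧
            (∀ y : Dom d n,
              -(∑ k, gradHatC (fun i => ε ((i : ℕ) + 1) / ε 1) n k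
                  (fun y' => ∑ l, A y' k l
                    * gradHatC (fun i' => ε ((i' : ℕ) + 1) / ε 1) n l X y') y)
                  + τ ^ 2 * X y
                = ∑ k, gradHatC (fun i => ε ((i : ℕ) + 1) / ε 1) n k
                    (fun y' => ∑ l, A y' k l * v l) y) ∧
            (∀ y : Dom d n, |X y| ≤ C) ∧
            (∀ ℓ : ℕ,
              L2 (fun y => ∑ k, DAbs ℓ
                    (fun y' => gradHatC (fun i => ε ((i : ℕ) + 1) / ε 1) n k X y') y)
                  + τ * L2 (DAbs ℓ X)
                ≤ Cstar * Λ ^ ℓ * (Nat.factorial ℓ : ℝ))) ∧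
          (∀ X' : Dom d n → ℝ,
            ContDiff ℝ (⊤ : ℕ∞) X' → MPeriodic X' →
            (∀ y : Dom d n,
              -(∑ k, gradHatC (fun i => ε ((i : ℕ) + 1) / ε 1) n k
                  (fun y' => ∑ l, A y' k l
                    * gradHatC (fun i' => ε ((i' : ℕ) + 1) / ε 1) n l X' y') y)
                  + τ ^ 2 * X' y
                = ∑ k, gradHatC (fun i => ε ((i : ℕ) + 1) / ε 1) n k
                    (fun y' => ∑ l, A y' k l * v l) y) →
            X' = X) := by
  have hn0 : 0 < n := by omega
  have hlam0 : 0 < lam := hlam.1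
  have hnR : (0 : ℝ) < n := by exact_mod_cast hn0
  have hdR : (0 : ℝ) < d := by exact_mod_cast hd
  obtain ⟨s, hs, hsσ, hsmall⟩ := exists_weight d n (K := 2 * C₀) (σ := π / (Λ₀ * (n * d)))
    (by positivity) (by positivity) hlam0
  obtain ⟨D, hD⟩ : ∃ D, D = 2 * (d * (d * (2 * C₀)) *
    expMass d n (π / (Λ₀ * (n * d)) - s)) / lam := ⟨_, rfl⟩
  have hs2 : 0 < s / 2 := half_pos hs
  have hE0 : 0 ≤ D * expMass d n (s / 2) := by
    have h1 := one_le_expMass (d := d) (n := n) (sub_pos.mpr hsσ)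
    have h2 := one_le_expMass (d := d) (n := n) hs2
    rw [hD]
    positivity
  set E := D * expMass d n (s / 2) with hE
  refine ⟨fun _ => 1, s / 2, max 1 E, max 1 ((d + 1) * E), max 1 (n * d * (4 * π / s)),
    fun _ _ _ => one_pos, hs2, le_max_left _ _, le_max_left _ _, le_max_left _ _, ?_⟩
  intro A hAs hAper hAell hAbd ε _ hεpos hεanti _ τ hτ hτres v hv
  have hτ0 : 0 < τ := hτ.1
  have hA : ∀ k l, ContPer fun y => A y k l := fun k l => ⟨(hAs k l).continuous, hAper k l⟩
  have hell : ∀ y (ξ : Fin d → ℝ), lam * ∑ k, ξ k ^ 2 ≤ ∑ k, ξ k * ∑ l, A y k l * ξ l :=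
    fun y ξ => (hAell y ξ).1
  have hdec : ∀ k l, ExpDecay (2 * C₀) (π / (Λ₀ * (n * d))) (coeff fun y => A y k l) := by
    intro k l
    refine coeff_expDecay (hAs k l) (hAper k l) (by positivity) hΛ₀ hd hn0 fun ℓ p y => ?_
    refine (abs_iteratedFDeriv_le_DAbs ℓ _ y p).trans (le_trans ?_ (hAbd ℓ y))
    exact (Finset.single_le_sum (f := fun l => DAbs ℓ (fun y' => A y' k l) y)
      (fun _ _ => DAbs_nonneg _ _ _) (Finset.mem_univ l)).trans
      (Finset.single_le_sum (f := fun k => ∑ l, DAbs ℓ (fun y' => A y' k l) y)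
        (fun _ _ => Finset.sum_nonneg fun _ _ => DAbs_nonneg _ _ _) (Finset.mem_univ k))
  have hvle : ∀ l, |v l| ≤ 1 := by
    intro l
    rw [← sq_le_one_iff_abs_le_one, ← hv]
    exact Finset.single_le_sum (f := fun k => v k ^ 2) (fun _ _ => sq_nonneg _)
      (Finset.mem_univ l)
  set δ : Fin n → ℝ := fun i => ε ((i : ℕ) + 1) / ε 1 with hδ
  have hε1 : 0 < ε 1 := hεpos 1 le_rfl (by omega)
  have hεi : ∀ i : Fin n, 0 < ε ((i : ℕ) + 1) := fun i => hεpos _ (by omega) (by omega)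
  have hεmono : ∀ i j : ℕ, 1 ≤ i → i ≤ j → j ≤ n → ε j ≤ ε i := by
    intro i j hi hij hj
    rcases hij.eq_or_lt with rfl | h
    · exact le_rfl
    · exact (hεanti i j hi h hj).le
  have hres := phase_hatVec_dichotomy (d := d) (δ := δ) (c := s / 2) (τ := τ)
    (fun i => div_pos (hεi i) hε1)
    (fun i => (div_le_one hε1).mpr (hεmono 1 _ le_rfl (by omega) (by omega)))
    (fun i j hij => div_le_div_of_nonneg_right
      (hεmono _ _ (by omega) (by have := Fin.le_def.mp hij; omega) (by omega)) hε1.le)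
    hτ0 hs2 (fun i j hij => by
      have h := hτres ((j : ℕ) + 1) (by omega) (by omega)
      rw [Nat.add_sub_cancel, ← hij] at h
      simp only [hδ]
      rw [div_div_div_cancel_right₀ hε1.ne', ← hij, ← mul_div_assoc]
      exact h)
  obtain ⟨x, hxdec, hgdec, hτdec, heq⟩ := exists_corrector hs hsσ hlam0 hlam.2 hτ0
    (by positivity) hA hdec hsmall hell (hatVec δ) hvle hres hD
  have hXs : ContDiff ℝ (⊤ : ℕ∞) fun y => (trig x y).re :=
    Complex.reCLM.contDiff.comp (hxdec.contDiff_trig hs2)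
  have hXper : MPeriodic fun y => (trig x y).re := fun y z =>
    congrArg Complex.re (trig_translate x y z)
  simp only [gradHatC_eq]
  refine ⟨fun y => (trig x y).re, ⟨hXs, hXper, heq, fun y => ?_, fun ℓ => ?_⟩,
    fun X' hXs' hXper' heq' => ?_⟩
  · exact ((Complex.abs_re_le_norm _).trans (hxdec.norm_trig_le hs2 y)).trans (le_max_right _ _)
  · set M := E * (n * d * (4 * π / s)) ^ ℓ * (ℓ.factorial : ℝ) with hM
    have hM0 : 0 ≤ M := by positivity
    have h1 : L2 (fun y => ∑ k, DAbs ℓ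
        (fun y' => fderiv ℝ (fun y => (trig x y).re) y' (hatVec δ k)) y) ≤ d * M := by
      refine L2_le (by positivity) fun y => ?_
      rw [abs_of_nonneg (Finset.sum_nonneg fun _ _ => DAbs_nonneg _ _ _)]
      have h : ∀ k ∈ (Finset.univ : Finset (Fin d)), DAbs ℓ
          (fun y' => fderiv ℝ (fun y => (trig x y).re) y' (hatVec δ k)) y ≤ M := by
        intro k _
        simp only [hxdec.fderiv_trig_re hs2]
        exact DAbs_trig_re_le (hgdec k) hs ℓ y
      refine (Finset.sum_le_card_nsmul _ _ _ h).trans (le_of_eq ?_)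
      rw [Finset.card_univ, Fintype.card_fin, nsmul_eq_mul]
    have h2 : τ * L2 (DAbs ℓ fun y => (trig x y).re) ≤ M := by
      rw [← le_div_iff₀' hτ0]
      refine L2_le (by positivity) fun y => ?_
      rw [abs_of_nonneg (DAbs_nonneg _ _ _), le_div_iff₀' hτ0, ← DAbs_const_mul hXs hτ0.le]
      have h3 : (fun y => τ * (trig x y).re) = fun y => (trig (fun m => (τ : ℂ) * x m) y).re := by
        funext y
        rw [← Complex.re_ofReal_mul]
        simp only [trig, mul_assoc]
        rw [tsum_mul_left]
      rw [h3]
      exact DAbs_trig_re_le hτdec hs ℓ y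
    calc _ ≤ d * M + M := add_le_add h1 h2
      _ = (d + 1) * E * (n * d * (4 * π / s)) ^ ℓ * (ℓ.factorial : ℝ) := by rw [hM]; ring
      _ ≤ _ := by
        gcongr
        · exact le_max_right _ _
        · exact le_max_right _ _
  · exact corrector_unique hlam0 hτ0 hAs hA hell (hatVec δ) hXs hXper hXs' hXper'
      fun y => (heq y).trans (heq' y).symm

end MS
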